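/- Let n ≥ 2. The motion-group Fourier transform 𝓕_G, sending f to F(r,ω) = f̂(rω) = ∫_{ℝⁿ} f(x) e^{-2πi r ω·x} dx (r ∈ ℝ, ω ∈ S^{n-1}), is a topological isomorphism of the Schwartz space 𝒮(ℝⁿ) onto 𝒮^{ℤ₂}_H(ℝ×S^{n-1}). -/

import Mathlib

open MeasureTheory Real Complex Finset

noncomputable section

variable {n : ℕ}

/-- The motion-group Fourier transform `f ↦ ((r,ω) ↦ f̂(rω))`, extended degree-zero
homogeneously in the angular variable: for `x ≠ 0`,
`SFT f (r, x) = ∫ f(y) e^{-2πi r (y·x/‖x‖)} dy = f̂(r x/‖x‖)`. -/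
def SFT (f : EuclideanSpace ℝ (Fin n) → ℂ)
    (q : ℝ × EuclideanSpace ℝ (Fin n)) : ℂ :=
  ∫ y : EuclideanSpace ℝ (Fin n),
    f y * Complex.exp (-(2 * (π : ℂ) * Complex.I) * (q.1 : ℂ) *
      (((∑ i, y i * q.2 i) / ‖q.2‖ : ℝ) : ℂ))

/-- The seminorms `|·|_{k,l,D}` of `𝒮^{ℤ₂}_H(ℝ × S^{n-1})`: the full iterated derivative
of order `m` on `ℝ × (ℝⁿ∖{0})` encodes all products `(∂/∂r)^l D_ω` of radial derivatives
and differential operators on the sphere. -/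
def shSemi (k m : ℕ) (F : ℝ × EuclideanSpace ℝ (Fin n) → ℂ) : ℝ :=
  ⨆ (r : ℝ), ⨆ (ω : EuclideanSpace ℝ (Fin n)), ⨆ (_ : ‖ω‖ = 1),
    (1 + r ^ 2) ^ k *
      ‖iteratedFDerivWithin ℝ m F
        (Set.univ ×ˢ {x : EuclideanSpace ℝ (Fin n) | x ≠ 0}) (r, ω)‖

/-- Membership in `𝒮^{ℤ₂}_H(ℝ × S^{n-1})`.  Functions on `ℝ × S^{n-1}` are identified
with functions on `ℝ × (ℝⁿ∖{0})` that are degree-zero homogeneous in the second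
variable.  The conditions are: evenness; smoothness; the `k`-th Taylor coefficient in
`r` at `r = 0` is a homogeneous polynomial of degree `k` in `ω`; and all seminorms
`|·|_{k,l,D}` are finite. -/
def IsSHZ2 (F : ℝ × EuclideanSpace ℝ (Fin n) → ℂ) : Prop :=
  (∀ (r t : ℝ) (x : EuclideanSpace ℝ (Fin n)), 0 < t → F (r, t • x) = F (r, x)) ∧
  (∀ (r : ℝ) (x : EuclideanSpace ℝ (Fin n)), F (-r, -x) = F (r, x)) ∧
  ContDiffOn ℝ (⊤ : ℕ∞) F (Set.univ ×ˢ {x : EuclideanSpace ℝ (Fin n) | x ≠ 0}) ∧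
  (∀ k : ℕ, ∃ P : MvPolynomial (Fin n) ℂ, P.IsHomogeneous k ∧
    ∀ ω : EuclideanSpace ℝ (Fin n), ‖ω‖ = 1 →
      iteratedDeriv k (fun r : ℝ => F (r, ω)) 0 =
        MvPolynomial.eval (fun i => (ω i : ℂ)) P) ∧
  (∀ k m : ℕ, ∃ C : ℝ, ∀ (r : ℝ) (ω : EuclideanSpace ℝ (Fin n)), ‖ω‖ = 1 →
    (1 + r ^ 2) ^ k *
      ‖iteratedFDerivWithin ℝ m F
        (Set.univ ×ˢ {x : EuclideanSpace ℝ (Fin n) | x ≠ 0}) (r, ω)‖ ≤ C)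

section SmoothTransforms

local notation "∞" => ((⊤ : ℕ∞) : WithTop ℕ∞)

section FaaDiBruno

variable {V W X : Type*} [NormedAddCommGroup V] [NormedSpace ℝ V] [NormedAddCommGroup W]
  [NormedSpace ℝ W] [NormedAddCommGroup X] [NormedSpace ℝ X]

lemma norm_iteratedFDeriv_comp_le_of_isOpen {g : W → X} {f : V → W} {m : ℕ} {s : Set V}
    {t : Set W} {x : V} (hs : IsOpen s) (ht : IsOpen t) (hg : ContDiffOn ℝ ∞ g t)
    (hf : ContDiffOn ℝ ∞ f s) (hst : Set.MapsTo f s t) (hx : x ∈ s) {C D : ℝ}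
    (hC : ∀ i ≤ m, ‖iteratedFDeriv ℝ i g (f x)‖ ≤ C)
    (hD : ∀ i, 1 ≤ i → i ≤ m → ‖iteratedFDeriv ℝ i f x‖ ≤ D ^ i) :
    ‖iteratedFDeriv ℝ m (g ∘ f) x‖ ≤ m.factorial * C * D ^ m := by
  rw [← iteratedFDerivWithin_of_isOpen m hs hx]
  refine norm_iteratedFDerivWithin_comp_le hg hf (mod_cast le_top) ht.uniqueDiffOn
    hs.uniqueDiffOn hst hx ?_ ?_
  · intro i hi
    rw [iteratedFDerivWithin_of_isOpen i ht (hst hx)]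
    exact hC i hi
  · intro i h1 hi
    rw [iteratedFDerivWithin_of_isOpen i hs hx]
    exact hD i h1 hi

/-- The iterated derivatives of a smooth function are bounded on compact sets. -/
lemma exists_norm_iteratedFDeriv_le_of_isCompact {f : V → W} {s K : Set V} (hs : IsOpen s)
    (hf : ContDiffOn ℝ ∞ f s) (hK : IsCompact K) (hKs : K ⊆ s) (m : ℕ) :
    ∃ C, 1 ≤ C ∧ ∀ i ≤ m, ∀ x ∈ K, ‖iteratedFDeriv ℝ i f x‖ ≤ C := by
  induction m with
  | zero =>
    have hc : ContinuousOn (iteratedFDeriv ℝ 0 f) K :=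
      ((hf.continuousOn_iteratedFDerivWithin (m := 0) (mod_cast le_top) hs.uniqueDiffOn).congr
        fun x hx => (iteratedFDerivWithin_of_isOpen 0 hs hx).symm).mono hKs
    obtain ⟨C, hC⟩ := hK.exists_bound_of_continuousOn hc
    refine ⟨max 1 C, le_max_left _ _, fun i hi x hx => ?_⟩
    obtain rfl : i = 0 := by omega
    exact (hC x hx).trans (le_max_right _ _)
  | succ m ih =>
    obtain ⟨C', h1, hC'⟩ := ih
    have hc : ContinuousOn (iteratedFDeriv ℝ (m + 1) f) K :=
      ((hf.continuousOn_iteratedFDerivWithin (m := m + 1) (mod_cast le_top)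
        hs.uniqueDiffOn).congr
        fun x hx => (iteratedFDerivWithin_of_isOpen (m + 1) hs hx).symm).mono hKs
    obtain ⟨C, hC⟩ := hK.exists_bound_of_continuousOn hc
    refine ⟨max C' C, h1.trans (le_max_left _ _), fun i hi x hx => ?_⟩
    rcases Nat.lt_or_ge m i with h | h
    · obtain rfl : i = m + 1 := by omega
      exact (hC x hx).trans (le_max_right _ _)
    · exact (hC' i h x hx).trans (le_max_left _ _)

lemma contDiffOn_iteratedFDeriv_of_isOpen {f : V → W} {s : Set V} (hs : IsOpen s)
    (hf : ContDiffOn ℝ ∞ f s) (i : ℕ) : ContDiffOn ℝ ∞ (iteratedFDeriv ℝ i f) s := by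
  intro x hx
  exact (((hf.contDiffAt (hs.mem_nhds hx)).iteratedFDeriv_right (i := i) (m := ∞)
    (mod_cast le_top))).contDiffWithinAt

/-- A function that is smooth away from the origin and whose derivatives up to order `m` are
quadratically small near the origin is of class `C^m`. -/
lemma contDiff_of_norm_iteratedFDeriv_le_sq {h : V → W} {m : ℕ} {C : ℝ} (h0 : h 0 = 0)
    (hh : ContDiffOn ℝ ∞ h {0}ᶜ)
    (hb : ∀ j ≤ m, ∀ ξ : V, ξ ≠ 0 → ‖ξ‖ ≤ 1 → ‖iteratedFDeriv ℝ j h ξ‖ ≤ C * ‖ξ‖ ^ 2) :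
    ContDiff ℝ m h ∧ ∀ j ≤ m, iteratedFDeriv ℝ j h 0 = 0 := by
  have hder : ∀ j ≤ m, iteratedFDeriv ℝ j h 0 = 0 →
      HasFDerivAt (iteratedFDeriv ℝ j h) (0 : V →L[ℝ] _) 0 := by
    intro j hj hz
    rw [hasFDerivAt_iff_isLittleO_nhds_zero]
    simp only [zero_add, hz, sub_zero, zero_apply]
    have hO : (fun ξ : V => iteratedFDeriv ℝ j h ξ) =O[nhds 0] fun ξ => ‖ξ‖ ^ 2 := by
      refine Asymptotics.IsBigO.of_bound C ?_
      filter_upwards [Metric.closedBall_mem_nhds (0 : V) one_pos] with ξ hξ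
      by_cases h : ξ = 0
      · subst h; simp [hz]
      · simpa using hb j hj ξ h (by simpa using hξ)
    refine hO.trans_isLittleO ?_
    have := Asymptotics.isLittleO_norm_pow_id (E' := V) (n := 2) (by norm_num)
    exact this
  have hz : ∀ j ≤ m, iteratedFDeriv ℝ j h 0 = 0 := by
    intro j
    induction j with
    | zero =>
      intro _
      ext v
      simp [h0]
    | succ j ih =>
      intro hj
      have h1 := hder j (by omega) (ih (by omega))
      rw [iteratedFDeriv_succ_eq_comp_left, Function.comp_apply, h1.fderiv]
      exact LinearIsometryEquiv.map_zero _
  refine ⟨?_, hz⟩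
  refine contDiff_of_differentiable_iteratedFDeriv (n := (m : ℕ∞)) fun j hj ξ => ?_
  have hj' : j ≤ m := by exact_mod_cast hj
  by_cases h : ξ = 0
  · subst h; exact (hder j hj' (hz j hj')).differentiableAt
  · exact ((contDiffOn_iteratedFDeriv_of_isOpen isOpen_compl_singleton hh j).contDiffAt
      (isOpen_compl_singleton.mem_nhds h)).differentiableAt (by simp)

end FaaDiBruno

section RadialDeriv

variable {V W : Type} [NormedAddCommGroup V] [NormedSpace ℝ V] [NormedAddCommGroup W]
  [NormedSpace ℝ W]

/-- The derivative in the first variable of a function on `ℝ × V`. -/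
def radialDeriv (G : ℝ × V → W) (p : ℝ × V) : W := fderiv ℝ G p (1, 0)

lemma ContDiffOn.fderiv_infty {s : Set (ℝ × V)} (hs : IsOpen s) {G : ℝ × V → W}
    (hG : ContDiffOn ℝ ∞ G s) : ContDiffOn ℝ ∞ (fderiv ℝ G) s :=
  hG.fderiv_of_isOpen hs (by simp)

lemma ContDiffOn.radialDeriv {s : Set (ℝ × V)} (hs : IsOpen s) {G : ℝ × V → W}
    (hG : ContDiffOn ℝ ∞ G s) : ContDiffOn ℝ ∞ (radialDeriv G) s :=
  (hG.fderiv_infty hs).clm_apply contDiffOn_const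

lemma ContDiffOn.radialDeriv_iterate {s : Set (ℝ × V)} (hs : IsOpen s) {G : ℝ × V → W}
    (hG : ContDiffOn ℝ ∞ G s) (k : ℕ) : ContDiffOn ℝ ∞ (_root_.radialDeriv^[k] G) s := by
  induction k with
  | zero => exact hG
  | succ k ih => rw [Function.iterate_succ_apply']; exact ih.radialDeriv hs

lemma hasDerivAt_slice {G : ℝ × V → W} {r : ℝ} {x : V} (hG : DifferentiableAt ℝ G (r, x)) :
    HasDerivAt (fun r => G (r, x)) (radialDeriv G (r, x)) r := by
  have h1 : HasDerivAt (fun r : ℝ => (r, x)) ((1 : ℝ), (0 : V)) r :=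
    (hasDerivAt_id r).prodMk (hasDerivAt_const r x)
  exact hG.hasFDerivAt.comp_hasDerivAt r h1

lemma iteratedDeriv_slice {U : Set V} (hU : IsOpen U) {G : ℝ × V → W}
    (hG : ContDiffOn ℝ ∞ G (Set.univ ×ˢ U)) {x : V} (hx : x ∈ U) (k : ℕ) :
    iteratedDeriv k (fun r => G (r, x)) = fun r => (radialDeriv^[k] G) (r, x) := by
  have hs : IsOpen ((Set.univ : Set ℝ) ×ˢ U) := isOpen_univ.prod hU
  induction k with
  | zero => simp
  | succ k ih =>
    rw [iteratedDeriv_succ, ih]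
    ext r
    rw [Function.iterate_succ_apply']
    exact (hasDerivAt_slice (((hG.radialDeriv_iterate hs k).contDiffAt
      (hs.mem_nhds (by simp [hx]))).differentiableAt (by simp))).deriv

lemma radialDeriv_fderiv {s : Set (ℝ × V)} (hs : IsOpen s) {G : ℝ × V → W}
    (hG : ContDiffOn ℝ ∞ G s) {p : ℝ × V} (hp : p ∈ s) :
    radialDeriv (fderiv ℝ G) p = fderiv ℝ (radialDeriv G) p := by
  have hsymm : IsSymmSndFDerivAt ℝ G p :=
    (hG.contDiffAt (hs.mem_nhds hp)).isSymmSndFDerivAt (by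
      simpa using (WithTop.coe_le_coe.2 le_top : ((2 : ℕ∞) : WithTop ℕ∞) ≤ ∞))
  have hd : DifferentiableAt ℝ (fderiv ℝ G) p :=
    ((hG.fderiv_infty hs).contDiffAt (hs.mem_nhds hp)).differentiableAt (by simp)
  refine ContinuousLinearMap.ext fun v => ?_
  have : fderiv ℝ (radialDeriv G) p v = fderiv ℝ (fderiv ℝ G) p v (1, 0) := by
    have := hd.hasFDerivAt.clm_apply (hasFDerivAt_const ((1 : ℝ), (0 : V)) p)
    have h2 := this.fderiv
    change fderiv ℝ (fun y => fderiv ℝ G y (1, 0)) p v = _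
    rw [h2]
    simp
  rw [this]
  exact hsymm _ _

lemma radialDeriv_congr {s : Set (ℝ × V)} (hs : IsOpen s) {G H : ℝ × V → W}
    (h : Set.EqOn G H s) : Set.EqOn (radialDeriv G) (radialDeriv H) s := by
  intro p hp
  have : G =ᶠ[nhds p] H := Filter.eventuallyEq_of_mem (hs.mem_nhds hp) h
  simp only [radialDeriv, this.fderiv_eq]

lemma radialDeriv_iterate_fderiv {s : Set (ℝ × V)} (hs : IsOpen s) {G : ℝ × V → W}
    (hG : ContDiffOn ℝ ∞ G s) (k : ℕ) :
    Set.EqOn (radialDeriv^[k] (fderiv ℝ G)) (fderiv ℝ (radialDeriv^[k] G)) s := by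
  induction k with
  | zero => exact fun _ _ => rfl
  | succ k ih =>
    rw [Function.iterate_succ_apply', Function.iterate_succ_apply']
    exact (radialDeriv_congr hs ih).trans
      fun p hp => radialDeriv_fderiv hs (hG.radialDeriv_iterate hs k) hp

end RadialDeriv

/-- If the first `N` derivatives in the radial variable vanish at radius zero, then so do all
derivatives of order less than `N`. -/
lemma iteratedFDeriv_eq_zero_of_radialDeriv {V : Type} [NormedAddCommGroup V] [NormedSpace ℝ V]
    {U : Set V} (hU : IsOpen U) (i : ℕ) :
    ∀ {W : Type} [NormedAddCommGroup W] [NormedSpace ℝ W] {G : ℝ × V → W},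
      ContDiffOn ℝ ∞ G (Set.univ ×ˢ U) →
      (∀ k ≤ i, ∀ x ∈ U, (radialDeriv^[k] G) (0, x) = 0) →
      ∀ x ∈ U, iteratedFDeriv ℝ i G (0, x) = 0 := by
  have hs : IsOpen ((Set.univ : Set ℝ) ×ˢ U) := isOpen_univ.prod hU
  induction i with
  | zero =>
    intro W _ _ G hG hz x hx
    ext v
    simpa using hz 0 le_rfl x hx
  | succ i ih =>
    intro W _ _ G hG hz x hx
    have := ih (G := fderiv ℝ G) (hG.fderiv_infty hs) ?_ x hx
    · rw [iteratedFDeriv_succ_eq_comp_right, Function.comp_apply, this]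
      exact LinearIsometryEquiv.map_zero _
    · intro k hk y hy
      have hmem : ((0 : ℝ), y) ∈ (Set.univ : Set ℝ) ×ˢ U := by simp [hy]
      rw [radialDeriv_iterate_fderiv hs hG k hmem]
      have hd : DifferentiableAt ℝ (radialDeriv^[k] G) (0, y) :=
        ((hG.radialDeriv_iterate hs k).contDiffAt (hs.mem_nhds hmem)).differentiableAt (by simp)
      have h1 : fderiv ℝ (radialDeriv^[k] G) (0, y) (1, 0) = 0 := by
        have := hz (k + 1) (by omega) y hy
        rwa [Function.iterate_succ_apply'] at this
      have h2 : ∀ w : V, fderiv ℝ (radialDeriv^[k] G) (0, y) (0, w) = 0 := by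
        intro w
        have hc : HasFDerivAt (fun z : V => (radialDeriv^[k] G) (0, z))
            ((fderiv ℝ (radialDeriv^[k] G) (0, y)).comp (ContinuousLinearMap.inr ℝ ℝ V)) y :=
          hd.hasFDerivAt.comp y (hasFDerivAt_prodMk_right (0 : ℝ) y)
        have hc0 : HasFDerivAt (fun z : V => (radialDeriv^[k] G) (0, z))
            (0 : V →L[ℝ] W) y := by
          refine (hasFDerivAt_const (0 : W) y).congr_of_eventuallyEq ?_
          filter_upwards [hU.mem_nhds hy] with z hzU
          exact hz k (by omega) z hzU
        have := DFunLike.congr_fun (hc.unique hc0) w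
        simpa using this
      refine ContinuousLinearMap.ext fun v => ?_
      obtain ⟨a, w⟩ := v
      have : ((a, w) : ℝ × V) = a • ((1 : ℝ), (0 : V)) + ((0 : ℝ), w) := by simp
      rw [this, map_add, map_smul, h1, h2]
      simp

lemma norm_iteratedFDeriv_le_pow_mul {V W : Type} [NormedAddCommGroup V] [NormedSpace ℝ V]
    [NormedAddCommGroup W] [NormedSpace ℝ W] {U : Set V} (hU : IsOpen U) {G : ℝ × V → W}
    (hG : ContDiffOn ℝ ∞ G (Set.univ ×ˢ U)) {N : ℕ} {x : V} (hx : x ∈ U) {B : ℝ}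
    (hz : ∀ i < N, iteratedFDeriv ℝ i G (0, x) = 0)
    (hB : ∀ r : ℝ, |r| ≤ 1 → ‖iteratedFDeriv ℝ N G (r, x)‖ ≤ B) (d : ℕ) :
    ∀ i, i + d = N → ∀ r : ℝ, |r| ≤ 1 → ‖iteratedFDeriv ℝ i G (r, x)‖ ≤ B * |r| ^ d := by
  have hs : IsOpen ((Set.univ : Set ℝ) ×ˢ U) := isOpen_univ.prod hU
  have hB0 : 0 ≤ B := (norm_nonneg _).trans (hB 0 (by simp))
  induction d with
  | zero =>
    rintro i rfl r hr
    simpa using hB r hr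
  | succ d ih =>
    intro i hi r hr
    have hder : ∀ t ∈ Metric.closedBall (0 : ℝ) |r|,
        HasDerivWithinAt (fun t => iteratedFDeriv ℝ i G (t, x))
          (radialDeriv (iteratedFDeriv ℝ i G) (t, x)) (Metric.closedBall (0 : ℝ) |r|) t :=
      fun t _ => (hasDerivAt_slice (((contDiffOn_iteratedFDeriv_of_isOpen hs hG i).contDiffAt
        (hs.mem_nhds (by simp [hx]))).differentiableAt (by simp))).hasDerivWithinAt
    have hbd : ∀ t ∈ Metric.closedBall (0 : ℝ) |r|,
        ‖radialDeriv (iteratedFDeriv ℝ i G) (t, x)‖ ≤ B * |r| ^ d := by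
      intro t ht
      have ht' : |t| ≤ |r| := by simpa using ht
      have h1 : ‖radialDeriv (iteratedFDeriv ℝ i G) (t, x)‖
          ≤ ‖fderiv ℝ (iteratedFDeriv ℝ i G) (t, x)‖ * ‖((1 : ℝ), (0 : V))‖ :=
        ContinuousLinearMap.le_opNorm _ _
      rw [norm_fderiv_iteratedFDeriv] at h1
      have h2 : ‖((1 : ℝ), (0 : V))‖ = 1 := by simp [Prod.norm_def]
      rw [h2, mul_one] at h1
      refine h1.trans ((ih (i + 1) (by omega) t (ht'.trans hr)).trans ?_)
      gcongr
    have := (convex_closedBall (0 : ℝ) |r|).norm_image_sub_le_of_norm_hasDerivWithin_le hder hbd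
      (x := 0) (y := r) (by simp) (by simp)
    simp only [hz i (by omega), sub_zero, Real.norm_eq_abs] at this
    rw [pow_succ, ← mul_assoc]
    exact this

lemma norm_iteratedFDeriv_comp_clm_le {V W X : Type*} [NormedAddCommGroup V] [NormedSpace ℝ V]
    [NormedAddCommGroup W] [NormedSpace ℝ W] [NormedAddCommGroup X] [NormedSpace ℝ X]
    (L : V →L[ℝ] W) {f : W → X} {s : Set W} (hs : IsOpen s) (hf : ContDiffOn ℝ ∞ f s) {x : V}
    (hx : L x ∈ s) (i : ℕ) :
    ‖iteratedFDeriv ℝ i (f ∘ L) x‖ ≤ ‖iteratedFDeriv ℝ i f (L x)‖ * ‖L‖ ^ i := by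
  have hs' : IsOpen (L ⁻¹' s) := hs.preimage L.continuous
  rw [← iteratedFDerivWithin_of_isOpen i hs' (show x ∈ L ⁻¹' s from hx),
    L.iteratedFDerivWithin_comp_right hf hs.uniqueDiffOn hs'.uniqueDiffOn hx (mod_cast le_top),
    iteratedFDerivWithin_of_isOpen i hs hx]
  refine (ContinuousMultilinearMap.norm_compContinuousLinearMap_le _ _).trans ?_
  simp

/-- The open set `ℝ × (V ∖ {0})` on which functions on `ℝ × S^{n-1}` are extended. -/
lemma isOpen_univ_prod_ne_zero (V : Type*) [NormedAddCommGroup V] :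
    IsOpen ((Set.univ : Set ℝ) ×ˢ {x : V | x ≠ 0}) :=
  isOpen_univ.prod isOpen_ne

section Polar

variable {V : Type} [NormedAddCommGroup V] [InnerProductSpace ℝ V]

lemma contDiffOn_norm_prodMk : ContDiffOn ℝ ∞ (fun ξ : V => (‖ξ‖, ξ)) {0}ᶜ := fun _ hξ =>
  ((contDiffAt_norm ℝ hξ).prodMk contDiffAt_id).contDiffWithinAt

lemma ContDiffOn.comp_norm_prodMk {W : Type} [NormedAddCommGroup W] [NormedSpace ℝ W]
    {F : ℝ × V → W} (hF : ContDiffOn ℝ ∞ F (Set.univ ×ˢ {x : V | x ≠ 0})) :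
    ContDiffOn ℝ ∞ (fun ξ : V => F (‖ξ‖, ξ)) {0}ᶜ :=
  hF.comp contDiffOn_norm_prodMk fun _ hξ => ⟨Set.mem_univ _, hξ⟩

lemma exists_norm_iteratedFDeriv_comp_norm_prodMk_le [ProperSpace V] {W : Type}
    [NormedAddCommGroup W] [NormedSpace ℝ W] (m : ℕ) :
    ∃ C > (0 : ℝ), ∀ F : ℝ × V → W, ContDiffOn ℝ ∞ F (Set.univ ×ˢ {x : V | x ≠ 0}) →
      (∀ (r t : ℝ) (x : V), 0 < t → F (r, t • x) = F (r, x)) →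
      ∀ (ρ : ℝ) (η : V) (B : ℝ), 0 < ρ → ‖η‖ = 1 →
      (∀ i ≤ m, ‖iteratedFDeriv ℝ i F (ρ, η)‖ ≤ B) →
      ‖iteratedFDeriv ℝ m (fun ξ : V => F (‖ξ‖, ξ)) (ρ • η)‖ ≤ C * B * (max 1 ρ / ρ) ^ m := by
  obtain ⟨C₀, hC₀, hC⟩ := exists_norm_iteratedFDeriv_le_of_isCompact
    (isOpen_compl_singleton (x := (0 : V))) contDiffOn_norm_prodMk (isCompact_sphere (0 : V) 1)
    (fun x hx h => by simp [Set.mem_singleton_iff.1 h] at hx) m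
  refine ⟨m.factorial * C₀ ^ m, by positivity, fun F hF hhom ρ η B hρ hη hB => ?_⟩
  have hη0 : η ≠ 0 := by rintro rfl; simp at hη
  set L : ℝ × V →L[ℝ] ℝ × V :=
    (ρ • ContinuousLinearMap.fst ℝ ℝ V).prod (ContinuousLinearMap.snd ℝ ℝ V) with hL
  have hLn : ‖L‖ ≤ max 1 ρ := by
    refine L.opNorm_le_bound (by positivity) fun p => ?_
    have h1 : ‖L p‖ = max (ρ * |p.1|) ‖p.2‖ := by
      simp [hL, Prod.norm_def, abs_of_pos hρ]
    rw [h1, max_le_iff]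
    refine ⟨?_, ?_⟩
    · exact mul_le_mul (le_max_right _ _) (norm_fst_le p) (abs_nonneg _) (by positivity)
    · calc ‖p.2‖ = 1 * ‖p.2‖ := (one_mul _).symm
        _ ≤ _ := mul_le_mul (le_max_left _ _) (norm_snd_le p) (norm_nonneg _) (by positivity)
  set h : V → W := F ∘ (L ∘ fun ξ : V => (‖ξ‖, ξ)) with hh
  have hmaps : Set.MapsTo (L ∘ fun ξ : V => (‖ξ‖, ξ)) {0}ᶜ
      ((Set.univ : Set ℝ) ×ˢ {x : V | x ≠ 0}) := fun ξ hξ => ⟨Set.mem_univ _, hξ⟩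
  have hsm : ContDiffOn ℝ ∞ (L ∘ fun ξ : V => (‖ξ‖, ξ)) {0}ᶜ :=
    L.contDiff.comp_contDiffOn contDiffOn_norm_prodMk
  have hhsm : ContDiffOn ℝ ∞ h {0}ᶜ := hF.comp hsm hmaps
  have hb : ‖iteratedFDeriv ℝ m h η‖ ≤ m.factorial * B * (max 1 ρ * C₀) ^ m := by
    refine norm_iteratedFDeriv_comp_le_of_isOpen isOpen_compl_singleton
      (isOpen_univ_prod_ne_zero V) hF hsm hmaps hη0 ?_ ?_
    · intro i hi
      have : (L ∘ fun ξ : V => (‖ξ‖, ξ)) η = (ρ, η) := by simp [hL, hη]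
      rw [this]
      exact hB i hi
    · intro i h1 hi
      refine (L.norm_iteratedFDeriv_comp_left (contDiffOn_norm_prodMk.contDiffAt
        (isOpen_compl_singleton.mem_nhds hη0)) (N := ∞) (mod_cast le_top)).trans ?_
      calc ‖L‖ * ‖iteratedFDeriv ℝ i (fun ξ : V => (‖ξ‖, ξ)) η‖ ≤ max 1 ρ * C₀ :=
            mul_le_mul hLn (hC i hi η (by simpa using hη)) (norm_nonneg _) (by positivity)
        _ ≤ (max 1 ρ * C₀) ^ i :=
            le_self_pow₀ (one_le_mul_of_one_le_of_one_le (le_max_left _ _) hC₀) (by omega)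
  have hcomp : (fun ξ : V => F (‖ξ‖, ξ)) = h ∘ (ρ⁻¹ • ContinuousLinearMap.id ℝ V) := by
    ext ξ
    simp only [hh, hL, Function.comp_apply]
    simp [norm_smul, abs_of_pos hρ, hhom _ _ _ (inv_pos.2 hρ), hρ.ne']
  have hx : (ρ⁻¹ • ContinuousLinearMap.id ℝ V) (ρ • η) = η := by simp [smul_smul, hρ.ne']
  rw [hcomp]
  refine (norm_iteratedFDeriv_comp_clm_le (ρ⁻¹ • ContinuousLinearMap.id ℝ V)
    isOpen_compl_singleton hhsm (by rw [hx]; exact hη0) m).trans ?_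
  rw [hx]
  have hn : ‖ρ⁻¹ • ContinuousLinearMap.id ℝ V‖ ≤ ρ⁻¹ := by
    rw [norm_smul, Real.norm_eq_abs, abs_of_pos (inv_pos.2 hρ)]
    exact mul_le_of_le_one_right (by positivity) ContinuousLinearMap.norm_id_le
  have hB0 : 0 ≤ B := (norm_nonneg _).trans (hB 0 (Nat.zero_le _))
  calc _ ≤ (m.factorial * B * (max 1 ρ * C₀) ^ m) * (ρ⁻¹) ^ m := by gcongr
    _ = _ := by rw [div_eq_mul_inv, mul_pow, mul_pow]; ring

lemma contDiffOn_div_norm_smul :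
    ContDiffOn ℝ ∞ (fun q : ℝ × V => (q.1 / ‖q.2‖) • q.2) (Set.univ ×ˢ {x : V | x ≠ 0}) := by
  intro q hq
  have h2 : q.2 ≠ 0 := hq.2
  exact ((contDiffAt_fst.div ((contDiffAt_norm ℝ h2).comp q contDiffAt_snd)
    (by simpa using h2)).smul contDiffAt_snd).contDiffWithinAt

lemma exists_norm_iteratedFDeriv_comp_div_norm_smul_le [ProperSpace V] {W : Type}
    [NormedAddCommGroup W] [NormedSpace ℝ W] (m : ℕ) :
    ∃ C > (0 : ℝ), ∀ f : V → W, ContDiff ℝ ∞ f →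
      ∀ (r : ℝ) (ω : V) (B : ℝ), ‖ω‖ = 1 →
      (∀ i ≤ m, ‖iteratedFDeriv ℝ i f (r • ω)‖ ≤ B) →
      ‖iteratedFDeriv ℝ m (fun q : ℝ × V => f ((q.1 / ‖q.2‖) • q.2)) (r, ω)‖
        ≤ C * B * (max 1 |r|) ^ m := by
  obtain ⟨C₀, hC₀, hC⟩ := exists_norm_iteratedFDeriv_le_of_isCompact
    (isOpen_univ_prod_ne_zero V) contDiffOn_div_norm_smul
    ((isCompact_closedBall (0 : ℝ) 1).prod (isCompact_sphere (0 : V) 1))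
    (fun x hx => ⟨Set.mem_univ _, fun h => by simp [h] at hx⟩) m
  refine ⟨m.factorial * C₀ ^ m, by positivity, fun f hf r ω B hω hB => ?_⟩
  have hω0 : ω ≠ 0 := by rintro rfl; simp at hω
  set M := max 1 |r| with hM
  have hM1 : 1 ≤ M := le_max_left _ _
  have hM0 : 0 < M := by positivity
  set Θ : ℝ × V → V := fun q => (q.1 / ‖q.2‖) • q.2 with hΘ
  set L : ℝ × V →L[ℝ] ℝ × V :=
    (M⁻¹ • ContinuousLinearMap.fst ℝ ℝ V).prod (ContinuousLinearMap.snd ℝ ℝ V) with hL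
  have hLn : ‖L‖ ≤ 1 := by
    refine L.opNorm_le_bound zero_le_one fun p => ?_
    have h1 : ‖L p‖ = max (M⁻¹ * |p.1|) ‖p.2‖ := by
      simp [hL, Prod.norm_def, abs_of_pos hM0]
    rw [h1, max_le_iff, one_mul]
    exact ⟨(mul_le_of_le_one_left (abs_nonneg _) (inv_le_one_of_one_le₀ hM1)).trans
      (norm_fst_le p), norm_snd_le p⟩
  have hsm : ContDiffOn ℝ ∞ (Θ ∘ L) (Set.univ ×ˢ {x : V | x ≠ 0}) :=
    contDiffOn_div_norm_smul.comp L.contDiff.contDiffOn fun q hq => ⟨Set.mem_univ _, hq.2⟩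
  have hmem : ((r, ω) : ℝ × V) ∈ (Set.univ : Set ℝ) ×ˢ {x : V | x ≠ 0} :=
    ⟨Set.mem_univ _, hω0⟩
  have hLm : L (r, ω) = (M⁻¹ * r, ω) := by simp [hL]
  have hcomp : (fun q : ℝ × V => f ((q.1 / ‖q.2‖) • q.2)) =
      f ∘ ((M • ContinuousLinearMap.id ℝ V) ∘ (Θ ∘ L)) := by
    ext q
    simp only [hΘ, hL, Function.comp_apply]
    congr 1
    simp [smul_smul]
    congr 1
    field_simp
  rw [hcomp]
  have key : ‖iteratedFDeriv ℝ m (f ∘ ((M • ContinuousLinearMap.id ℝ V) ∘ (Θ ∘ L))) (r, ω)‖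
      ≤ m.factorial * B * (M * C₀) ^ m := by
    refine norm_iteratedFDeriv_comp_le_of_isOpen (isOpen_univ_prod_ne_zero V) isOpen_univ
      hf.contDiffOn ((M • ContinuousLinearMap.id ℝ V).contDiff.comp_contDiffOn hsm)
      (Set.mapsTo_univ _ _) hmem ?_ ?_
    · intro i hi
      have : ((M • ContinuousLinearMap.id ℝ V) ∘ (Θ ∘ L)) (r, ω) = r • ω := by
        simp [hΘ, hL, hω, smul_smul, hM0.ne']
      rw [this]
      exact hB i hi
    · intro i h1 hi
      refine ((M • ContinuousLinearMap.id ℝ V).norm_iteratedFDeriv_comp_left (hsm.contDiffAt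
        ((isOpen_univ_prod_ne_zero V).mem_nhds hmem)) (N := ∞) (mod_cast le_top)).trans ?_
      have h2 : ‖iteratedFDeriv ℝ i (Θ ∘ L) (r, ω)‖ ≤ C₀ := by
        refine (norm_iteratedFDeriv_comp_clm_le L (isOpen_univ_prod_ne_zero V)
          contDiffOn_div_norm_smul (by rw [hLm]; exact ⟨Set.mem_univ _, hω0⟩) i).trans ?_
        rw [hLm]
        refine (mul_le_of_le_one_right (norm_nonneg _)
          (pow_le_one₀ (norm_nonneg _) hLn)).trans (hC i hi _ ⟨?_, by simpa using hω⟩)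
        simp only [mem_closedBall_zero_iff, norm_mul, norm_inv, Real.norm_eq_abs,
          abs_of_pos hM0]
        rw [inv_mul_le_iff₀ hM0, mul_one]
        exact le_max_right _ _
      have h3 : ‖M • ContinuousLinearMap.id ℝ V‖ ≤ M := by
        rw [norm_smul, Real.norm_eq_abs, abs_of_pos hM0]
        exact mul_le_of_le_one_right (by positivity) ContinuousLinearMap.norm_id_le
      calc _ ≤ M * C₀ := mul_le_mul h3 h2 (norm_nonneg _) hM0.le
        _ ≤ (M * C₀) ^ i :=
            le_self_pow₀ (one_le_mul_of_one_le_of_one_le hM1 hC₀) (by omega)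
  refine key.trans (le_of_eq ?_)
  rw [mul_pow]; ring

end Polar

lemma exists_norm_eq_one_smul {n : ℕ} (hn : 0 < n) (x : EuclideanSpace ℝ (Fin n)) :
    ∃ ω : EuclideanSpace ℝ (Fin n), ‖ω‖ = 1 ∧ x = ‖x‖ • ω := by
  by_cases hx : x = 0
  · refine ⟨EuclideanSpace.single ⟨0, hn⟩ 1, by simp, by simp [hx]⟩
  · have : ‖x‖ ≠ 0 := norm_ne_zero_iff.2 hx
    exact ⟨‖x‖⁻¹ • x, by simp [norm_smul, this], by simp [smul_smul, this]⟩

lemma MvPolynomial.IsHomogeneous.eval_smul_real {n k : ℕ} {P : MvPolynomial (Fin n) ℂ}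
    (hP : P.IsHomogeneous k) (t : ℝ) (x : EuclideanSpace ℝ (Fin n)) :
    MvPolynomial.eval (fun i => ((t • x) i : ℂ)) P =
      (t : ℂ) ^ k * MvPolynomial.eval (fun i => (x i : ℂ)) P := by
  rw [MvPolynomial.eval_eq, MvPolynomial.eval_eq, Finset.mul_sum]
  refine Finset.sum_congr rfl fun d hd => ?_
  have hdeg : ∑ i ∈ d.support, d i = k := by
    have := hP (MvPolynomial.mem_support_iff.1 hd)
    rw [← this, Finsupp.weight_apply, Finsupp.sum]
    simp
  simp only [PiLp.smul_apply, smul_eq_mul, Complex.ofReal_mul, mul_pow, Finset.prod_mul_distrib]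
  rw [Finset.prod_pow_eq_pow_sum, hdeg]
  ring

lemma contDiff_eval_ofReal {n : ℕ} (P : MvPolynomial (Fin n) ℂ) :
    ContDiff ℝ ∞ (fun x : EuclideanSpace ℝ (Fin n) =>
      MvPolynomial.eval (fun i => (x i : ℂ)) P) := by
  have hcoord : ∀ i, ContDiff ℝ ∞ (fun x : EuclideanSpace ℝ (Fin n) => (x i : ℂ)) := fun i =>
    Complex.ofRealCLM.contDiff.comp (EuclideanSpace.proj (𝕜 := ℝ) i).contDiff
  induction P using MvPolynomial.induction_on with
  | C a => simpa using contDiff_const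
  | add p q hp hq => simpa using hp.add hq
  | mul_X p i hp => simpa using hp.mul (hcoord i)

/-- Homogeneous polynomials of degree `k` on `ℝⁿ` are spanned by finitely many of them, with
coefficients controlled by the supremum over the unit sphere. -/
lemma exists_homogeneous_spanning {n : ℕ} (hn : 0 < n) (k : ℕ) :
    ∃ (d : ℕ) (φ : Fin d → EuclideanSpace ℝ (Fin n) → ℂ), (∀ i, ContDiff ℝ ∞ (φ i)) ∧
      (∀ i (t : ℝ) x, φ i (t • x) = (t : ℂ) ^ k * φ i x) ∧
      ∃ C > (0 : ℝ), ∀ P : MvPolynomial (Fin n) ℂ, P.IsHomogeneous k → ∃ c : Fin d → ℂ,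
        (∀ x : EuclideanSpace ℝ (Fin n),
          MvPolynomial.eval (fun i => (x i : ℂ)) P = ∑ i, c i * φ i x) ∧
        ∀ M : ℝ, (∀ ω : EuclideanSpace ℝ (Fin n), ‖ω‖ = 1 →
          ‖MvPolynomial.eval (fun i => (ω i : ℂ)) P‖ ≤ M) → ∀ i, ‖c i‖ ≤ C * M := by
  have : Module.Finite ℂ (MvPolynomial.homogeneousSubmodule (Fin n) ℂ k) :=
    Module.Finite.iff_fg.2 (MvPolynomial.homogeneousSubmodule_fg (Fin n) ℂ k)
  set b := Module.finBasis ℂ (MvPolynomial.homogeneousSubmodule (Fin n) ℂ k)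
  set d := Module.finrank ℂ (MvPolynomial.homogeneousSubmodule (Fin n) ℂ k)
  set φ : Fin d → EuclideanSpace ℝ (Fin n) → ℂ := fun i x =>
    MvPolynomial.eval (fun j => (x j : ℂ)) (b i : MvPolynomial (Fin n) ℂ) with hφ
  have hsm : ∀ i, ContDiff ℝ ∞ (φ i) := fun i => contDiff_eval_ofReal _
  have hhom : ∀ i (t : ℝ) x, φ i (t • x) = (t : ℂ) ^ k * φ i x := fun i t x =>
    MvPolynomial.IsHomogeneous.eval_smul_real (b i).2 t x
  let Φ : Fin d → C(Metric.sphere (0 : EuclideanSpace ℝ (Fin n)) 1, ℂ) := fun i =>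
    ⟨fun x => φ i x, (hsm i).continuous.comp continuous_subtype_val⟩
  let L := Fintype.linearCombination ℂ Φ
  have hLa : ∀ c (x : Metric.sphere (0 : EuclideanSpace ℝ (Fin n)) 1),
      L c x = ∑ i, c i * φ i x := by
    intro c x
    simp [L, Fintype.linearCombination_apply, Φ, ContinuousMap.sum_apply]
  have hlin : ∀ (c : Fin d → ℂ) (y : Fin n → ℂ), MvPolynomial.eval y ((∑ i, c i • b i :
      MvPolynomial.homogeneousSubmodule (Fin n) ℂ k) : MvPolynomial (Fin n) ℂ)
      = ∑ i, c i * MvPolynomial.eval y (b i : MvPolynomial (Fin n) ℂ) := by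
    intro c y
    simp [map_sum, MvPolynomial.smul_eval]
  have hker : LinearMap.ker L = ⊥ := by
    rw [LinearMap.ker_eq_bot']
    intro c hc
    have hz : ∑ i, c i • b i = 0 := by
      apply Subtype.ext
      refine MvPolynomial.funext_set (fun _ => Set.range ((↑) : ℝ → ℂ))
        (fun _ => Set.infinite_range_of_injective Complex.ofReal_injective) fun y hy => ?_
      choose x hx using fun i => hy i (Set.mem_univ i)
      obtain ⟨ω, hω, hxω⟩ := exists_norm_eq_one_smul hn (WithLp.toLp 2 x)
      have h1 : y = fun i => (((WithLp.toLp 2 x : EuclideanSpace ℝ (Fin n)) i : ℝ) : ℂ) := by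
        ext i; exact (hx i).symm
      have h2 : MvPolynomial.eval y ((∑ i, c i • b i :
          MvPolynomial.homogeneousSubmodule (Fin n) ℂ k) : MvPolynomial (Fin n) ℂ)
          = ∑ i, c i * φ i (WithLp.toLp 2 x) := by
        rw [h1, hlin]
      rw [h2, hxω]
      have h3 := hLa c ⟨ω, by simpa using hω⟩
      rw [hc] at h3
      simp only [hhom]
      simp only [ContinuousMap.zero_apply] at h3
      calc _ = (‖(WithLp.toLp 2 x : EuclideanSpace ℝ (Fin n))‖ : ℂ) ^ k *
            ∑ i, c i * φ i ω := by
            rw [Finset.mul_sum]; exact Finset.sum_congr rfl fun i _ => by ring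
        _ = _ := by rw [← h3]; simp
    ext i
    exact Fintype.linearIndependent_iff.1 b.linearIndependent c hz i
  obtain ⟨K, hK0, hK⟩ := L.exists_antilipschitzWith hker
  refine ⟨d, φ, hsm, hhom, K, hK0, fun P hP => ?_⟩
  have hrepr : ∀ x : EuclideanSpace ℝ (Fin n), MvPolynomial.eval (fun i => (x i : ℂ)) P =
      ∑ i, b.repr ⟨P, hP⟩ i * φ i x := by
    intro x
    have h1 : P = ((∑ i, b.repr ⟨P, hP⟩ i • b i :
        MvPolynomial.homogeneousSubmodule (Fin n) ℂ k) : MvPolynomial (Fin n) ℂ) := by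
      rw [b.sum_repr]
    conv_lhs => rw [h1, hlin]
  refine ⟨fun i => b.repr ⟨P, hP⟩ i, hrepr, fun M hM i => ?_⟩
  obtain ⟨ω₀, hω₀, -⟩ := exists_norm_eq_one_smul hn (0 : EuclideanSpace ℝ (Fin n))
  have hM0 : 0 ≤ M := (norm_nonneg _).trans (hM ω₀ hω₀)
  have h2 : ‖L (fun i => b.repr ⟨P, hP⟩ i)‖ ≤ M := by
    refine (ContinuousMap.norm_le _ hM0).2 fun x => ?_
    rw [hLa, ← hrepr]
    exact hM x (by simp)
  have h3 := hK.le_mul_dist (fun i => b.repr ⟨P, hP⟩ i) 0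
  rw [map_zero, dist_zero_right, dist_zero_right] at h3
  refine (norm_le_pi_norm (fun i => b.repr ⟨P, hP⟩ i) i).trans (h3.trans ?_)
  gcongr

section Seminorms

lemma prodMk_mem_of_norm_eq_one {V : Type*} [NormedAddCommGroup V] (r : ℝ) {ω : V}
    (hω : ‖ω‖ = 1) : (r, ω) ∈ (Set.univ : Set ℝ) ×ˢ {x : V | x ≠ 0} :=
  ⟨Set.mem_univ _, fun h => by simp [show ω = 0 from h] at hω⟩

lemma shSemi_le {F : ℝ × EuclideanSpace ℝ (Fin n) → ℂ} {k m : ℕ} {B : ℝ} (hB0 : 0 ≤ B)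
    (hB : ∀ (r : ℝ) (ω : EuclideanSpace ℝ (Fin n)), ‖ω‖ = 1 →
      (1 + r ^ 2) ^ k * ‖iteratedFDeriv ℝ m F (r, ω)‖ ≤ B) : shSemi k m F ≤ B := by
  refine Real.iSup_le (fun r => Real.iSup_le (fun ω => Real.iSup_le (fun hω => ?_) hB0) hB0) hB0
  rw [iteratedFDerivWithin_of_isOpen m (isOpen_univ_prod_ne_zero _)
    (prodMk_mem_of_norm_eq_one r hω)]
  exact hB r ω hω

lemma shSemi_nonneg (k m : ℕ) (F : ℝ × EuclideanSpace ℝ (Fin n) → ℂ) : 0 ≤ shSemi k m F :=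
  Real.iSup_nonneg fun _ => Real.iSup_nonneg fun _ => Real.iSup_nonneg fun _ => by positivity

lemma IsSHZ2.le_shSemi {F : ℝ × EuclideanSpace ℝ (Fin n) → ℂ} (hF : IsSHZ2 F) (k m : ℕ) (r : ℝ)
    {ω : EuclideanSpace ℝ (Fin n)} (hω : ‖ω‖ = 1) :
    (1 + r ^ 2) ^ k * ‖iteratedFDeriv ℝ m F (r, ω)‖ ≤ shSemi k m F := by
  obtain ⟨C, hC⟩ := hF.2.2.2.2 k m
  have hC0 : 0 ≤ C := le_trans (by positivity) (hC r ω hω)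
  rw [← iteratedFDerivWithin_of_isOpen m (isOpen_univ_prod_ne_zero _)
    (prodMk_mem_of_norm_eq_one r hω)]
  set a : ℝ → EuclideanSpace ℝ (Fin n) → ℝ := fun r ω => (1 + r ^ 2) ^ k *
      ‖iteratedFDerivWithin ℝ m F
        (Set.univ ×ˢ {x : EuclideanSpace ℝ (Fin n) | x ≠ 0}) (r, ω)‖ with ha
  have h3 : ∀ r ω, (⨆ (_ : ‖ω‖ = 1), a r ω) ≤ C := fun r ω =>
    Real.iSup_le (fun h => hC r ω h) hC0
  have h2 : ∀ r, (⨆ ω, ⨆ (_ : ‖ω‖ = 1), a r ω) ≤ C := fun r => Real.iSup_le (h3 r) hC0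
  calc a r ω = ⨆ (_ : ‖ω‖ = 1), a r ω := by simp [hω]
    _ ≤ ⨆ ω, ⨆ (_ : ‖ω‖ = 1), a r ω :=
      le_ciSup (f := fun ω => ⨆ (_ : ‖ω‖ = 1), a r ω) ⟨C, by rintro _ ⟨ω, rfl⟩; exact h3 r ω⟩ ω
    _ ≤ ⨆ r, ⨆ ω, ⨆ (_ : ‖ω‖ = 1), a r ω :=
      le_ciSup (f := fun r => ⨆ ω, ⨆ (_ : ‖ω‖ = 1), a r ω)
        ⟨C, by rintro _ ⟨r, rfl⟩; exact h2 r⟩ r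
    _ = shSemi k m F := rfl

lemma norm_radialDeriv_iterate_le {V W : Type} [NormedAddCommGroup V] [NormedSpace ℝ V]
    [NormedAddCommGroup W] [NormedSpace ℝ W] {s : Set (ℝ × V)} (hs : IsOpen s) {G : ℝ × V → W}
    (hG : ContDiffOn ℝ ∞ G s) (k : ℕ) {p : ℝ × V} (hp : p ∈ s) :
    ‖(radialDeriv^[k] G) p‖ ≤ ‖iteratedFDeriv ℝ k G p‖ := by
  have key : ∀ p ∈ s, (radialDeriv^[k] G) p = iteratedFDeriv ℝ k G p fun _ => ((1 : ℝ), (0 : V)) := by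
    induction k with
    | zero => intro p _; simp
    | succ k ih =>
      intro p hp
      rw [Function.iterate_succ_apply', iteratedFDeriv_succ_apply_left, _root_.radialDeriv]
      have he : (radialDeriv^[k] G) =ᶠ[nhds p]
          fun p => iteratedFDeriv ℝ k G p fun _ => ((1 : ℝ), (0 : V)) := by
        filter_upwards [hs.mem_nhds hp] with q hq using ih q hq
      rw [he.fderiv_eq]
      have hd : DifferentiableAt ℝ (iteratedFDeriv ℝ k G) p :=
        ((contDiffOn_iteratedFDeriv_of_isOpen hs hG k).contDiffAt
          (hs.mem_nhds hp)).differentiableAt (by simp)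
      exact congrArg (fun L => L ((1 : ℝ), (0 : V))) (hd.hasFDerivAt.continuousMultilinear_apply_const
        (fun _ => ((1 : ℝ), (0 : V)))).fderiv
  rw [key p hp]
  refine (ContinuousMultilinearMap.le_opNorm _ _).trans (mul_le_of_le_one_right (norm_nonneg _) ?_)
  simp [Prod.norm_def]

end Seminorms

section Taylor

open MvPolynomial in
lemma exists_norm_iteratedFDeriv_eval_le (hn : 0 < n) (k m : ℕ) :
    ∃ C > (0 : ℝ), ∀ P : MvPolynomial (Fin n) ℂ, P.IsHomogeneous k → ∀ M : ℝ,
      (∀ ω : EuclideanSpace ℝ (Fin n), ‖ω‖ = 1 → ‖eval (fun i => (ω i : ℂ)) P‖ ≤ M) →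
      ∀ j ≤ m, ∀ ξ : EuclideanSpace ℝ (Fin n), ‖ξ‖ ≤ 1 →
        ‖iteratedFDeriv ℝ j (fun x : EuclideanSpace ℝ (Fin n) => eval (fun i => (x i : ℂ)) P) ξ‖
          ≤ C * M := by
  obtain ⟨d, φ, hφ, -, C, hC, hP⟩ := exists_homogeneous_spanning hn k
  choose A hA1 hA using fun i => exists_norm_iteratedFDeriv_le_of_isCompact isOpen_univ
    (hφ i).contDiffOn (isCompact_closedBall (0 : EuclideanSpace ℝ (Fin n)) 1)
    (Set.subset_univ _) m
  have hA0 : 0 ≤ ∑ i, A i := Finset.sum_nonneg fun i _ => zero_le_one.trans (hA1 i)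
  refine ⟨C * (∑ i, A i) + 1, by positivity, fun P hPk M hM j hj ξ hξ => ?_⟩
  obtain ⟨c, hc, hcM⟩ := hP P hPk
  obtain ⟨ω₀, hω₀, -⟩ := exists_norm_eq_one_smul hn 0
  have hM0 : 0 ≤ M := (norm_nonneg _).trans (hM ω₀ hω₀)
  simp_rw [hc]
  have hsm : ∀ i, ContDiffAt ℝ j (φ i) ξ := fun i => ((hφ i).of_le (mod_cast le_top)).contDiffAt
  rw [iteratedFDeriv_fun_sum_apply fun i _ => contDiffAt_const.mul (hsm i)]
  calc _ ≤ ∑ i, (C * M) * A i := norm_sum_le_of_le _ fun i _ => ?_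
    _ = C * (∑ i, A i) * M := by rw [← Finset.mul_sum]; ring
    _ ≤ _ := by nlinarith
  simp_rw [← smul_eq_mul]
  rw [iteratedFDeriv_const_smul_apply' (hsm i), norm_smul, smul_eq_mul]
  exact mul_le_mul (hcM M hM i) (hA i j hj ξ (by simpa using hξ)) (norm_nonneg _) (by positivity)

/-- The polynomial of degree less than `N` with prescribed homogeneous parts. -/
def taylorSum (P : ℕ → MvPolynomial (Fin n) ℂ) (N : ℕ) (x : EuclideanSpace ℝ (Fin n)) : ℂ :=
  ∑ l ∈ Finset.range N, (l.factorial : ℂ)⁻¹ * MvPolynomial.eval (fun i => (x i : ℂ)) (P l)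

lemma contDiff_taylorSum (P : ℕ → MvPolynomial (Fin n) ℂ) (N : ℕ) :
    ContDiff ℝ ∞ (taylorSum P N) :=
  ContDiff.sum fun l _ => contDiff_const.mul (contDiff_eval_ofReal (P l))

lemma exists_norm_iteratedFDeriv_taylorSum_le (hn : 0 < n) (N m : ℕ) :
    ∃ C > (0 : ℝ), ∀ P : ℕ → MvPolynomial (Fin n) ℂ, (∀ l, (P l).IsHomogeneous l) → ∀ M : ℝ,
      (∀ l < N, ∀ ω : EuclideanSpace ℝ (Fin n), ‖ω‖ = 1 →
        ‖MvPolynomial.eval (fun i => (ω i : ℂ)) (P l)‖ ≤ M) →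
      0 ≤ M → ∀ j ≤ m, ∀ ξ : EuclideanSpace ℝ (Fin n), ‖ξ‖ ≤ 1 →
        ‖iteratedFDeriv ℝ j (taylorSum P N) ξ‖ ≤ C * M := by
  choose C hC0 hC using fun l => exists_norm_iteratedFDeriv_eval_le (n := n) hn l m
  have hS : 0 ≤ ∑ l ∈ Finset.range N, C l := Finset.sum_nonneg fun l _ => (hC0 l).le
  refine ⟨∑ l ∈ Finset.range N, C l + 1, by positivity, fun P hP M hM hM0 j hj ξ hξ => ?_⟩
  have hsm : ∀ l, ContDiffAt ℝ j (fun x : EuclideanSpace ℝ (Fin n) =>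
      MvPolynomial.eval (fun i => (x i : ℂ)) (P l)) ξ := fun l =>
    ((contDiff_eval_ofReal (P l)).of_le (mod_cast le_top)).contDiffAt
  unfold taylorSum
  rw [iteratedFDeriv_fun_sum_apply fun i _ => contDiffAt_const.mul (hsm i)]
  calc _ ≤ ∑ l ∈ Finset.range N, C l * M := norm_sum_le_of_le _ fun l hl => ?_
    _ = (∑ l ∈ Finset.range N, C l) * M := by rw [← Finset.sum_mul]
    _ ≤ _ := by nlinarith
  simp_rw [← smul_eq_mul (a := (l.factorial : ℂ)⁻¹)]
  rw [iteratedFDeriv_const_smul_apply' (hsm l), norm_smul, norm_inv, Complex.norm_natCast]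
  refine (mul_le_of_le_one_left (norm_nonneg _) (inv_le_one_of_one_le₀ ?_)).trans
    (hC l (P l) (hP l) M (hM l (Finset.mem_range.1 hl)) j hj ξ hξ)
  exact_mod_cast l.factorial_pos

lemma iteratedDeriv_taylorSum_smul {P : ℕ → MvPolynomial (Fin n) ℂ}
    (hP : ∀ l, (P l).IsHomogeneous l) {N k : ℕ} (hk : k < N) (x : EuclideanSpace ℝ (Fin n)) :
    iteratedDeriv k (fun r : ℝ => taylorSum P N (r • x)) 0 =
      MvPolynomial.eval (fun i => (x i : ℂ)) (P k) := by
  have h : (fun r : ℝ => taylorSum P N (r • x)) = fun r => ∑ l ∈ Finset.range N,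
      (r ^ l) • ((l.factorial : ℂ)⁻¹ * MvPolynomial.eval (fun i => (x i : ℂ)) (P l)) := by
    ext r
    refine Finset.sum_congr rfl fun l _ => ?_
    rw [(hP l).eval_smul_real, Complex.real_smul]
    push_cast
    ring
  rw [h, iteratedDeriv_fun_sum fun l _ => by fun_prop]
  rw [Finset.sum_eq_single k]
  · rw [iteratedDeriv_smul_const (by fun_prop), iteratedDeriv_fun_pow_zero, if_pos rfl,
      Complex.real_smul]
    have : (k.factorial : ℂ) ≠ 0 := by exact_mod_cast k.factorial_ne_zero
    push_cast
    field_simp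
  · intro l _ hl
    rw [iteratedDeriv_smul_const (by fun_prop), iteratedDeriv_fun_pow_zero, if_neg hl.symm,
      Nat.cast_zero, zero_smul]
  · intro h
    exact absurd (Finset.mem_range.2 hk) h

end Taylor

section Remainder

/-- The remainder of the radial Taylor expansion at radius zero. -/
def radialRemainder (F : ℝ × EuclideanSpace ℝ (Fin n) → ℂ) (P : ℕ → MvPolynomial (Fin n) ℂ)
    (N : ℕ) (q : ℝ × EuclideanSpace ℝ (Fin n)) : ℂ :=
  F q - taylorSum P N ((q.1 / ‖q.2‖) • q.2)

variable {F : ℝ × EuclideanSpace ℝ (Fin n) → ℂ} {P : ℕ → MvPolynomial (Fin n) ℂ}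

lemma contDiffOn_taylorSum_polar (P : ℕ → MvPolynomial (Fin n) ℂ) (N : ℕ) :
    ContDiffOn ℝ ∞ (fun q : ℝ × EuclideanSpace ℝ (Fin n) =>
      taylorSum P N ((q.1 / ‖q.2‖) • q.2)) (Set.univ ×ˢ {x | x ≠ 0}) :=
  (contDiff_taylorSum P N).comp_contDiffOn contDiffOn_div_norm_smul

lemma IsSHZ2.contDiffOn_radialRemainder (hF : IsSHZ2 F) (P : ℕ → MvPolynomial (Fin n) ℂ) (N : ℕ) :
    ContDiffOn ℝ ∞ (radialRemainder F P N) (Set.univ ×ˢ {x | x ≠ 0}) :=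
  hF.2.2.1.sub (contDiffOn_taylorSum_polar P N)

lemma div_norm_smul_smul {V : Type*} [NormedAddCommGroup V] [NormedSpace ℝ V] (r : ℝ) {t : ℝ}
    (ht : 0 < t) (x : V) : (r / ‖t • x‖) • t • x = (r / ‖x‖) • x := by
  rw [norm_smul, Real.norm_eq_abs, abs_of_pos ht, smul_smul]
  congr 1
  field_simp

lemma radialRemainder_norm_self (F : ℝ × EuclideanSpace ℝ (Fin n) → ℂ)
    (P : ℕ → MvPolynomial (Fin n) ℂ) (N : ℕ) (ξ : EuclideanSpace ℝ (Fin n)) :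
    radialRemainder F P N (‖ξ‖, ξ) = F (‖ξ‖, ξ) - taylorSum P N ξ := by
  by_cases h : ξ = 0
  · simp [radialRemainder, h]
  · simp [radialRemainder, div_self (norm_ne_zero_iff.2 h)]

lemma IsSHZ2.radialDeriv_radialRemainder (hF : IsSHZ2 F) (hP : ∀ l, (P l).IsHomogeneous l)
    (hPF : ∀ l, ∀ ω : EuclideanSpace ℝ (Fin n), ‖ω‖ = 1 →
      iteratedDeriv l (fun r : ℝ => F (r, ω)) 0 = MvPolynomial.eval (fun i => (ω i : ℂ)) (P l))
    {N k : ℕ} (hk : k < N) {x : EuclideanSpace ℝ (Fin n)} (hx : x ≠ 0) :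
    (radialDeriv^[k] (radialRemainder F P N)) (0, x) = 0 := by
  have hU : IsOpen {x : EuclideanSpace ℝ (Fin n) | x ≠ 0} := isOpen_ne
  have hpos : 0 < ‖x‖⁻¹ := inv_pos.2 (norm_pos_iff.2 hx)
  have hnorm : ‖‖x‖⁻¹ • x‖ = 1 := by simp [norm_smul, hx]
  rw [← congrFun (iteratedDeriv_slice hU (hF.contDiffOn_radialRemainder P N)
    (show x ∈ {x | x ≠ 0} from hx) k) 0]
  have he : (fun r : ℝ => radialRemainder F P N (r, x)) =
      fun r => F (r, ‖x‖⁻¹ • x) - taylorSum P N (r • (‖x‖⁻¹ • x)) := by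
    ext r
    simp only [radialRemainder, hF.1 _ _ _ hpos, smul_smul, div_eq_mul_inv]
  have hslice : ContDiff ℝ ∞ fun r : ℝ => F (r, ‖x‖⁻¹ • x) := by
    rw [← contDiffOn_univ]
    exact hF.2.2.1.comp (by fun_prop) fun r _ => prodMk_mem_of_norm_eq_one r hnorm
  have hT : ContDiff ℝ ∞ fun r : ℝ => taylorSum P N (r • (‖x‖⁻¹ • x)) :=
    (contDiff_taylorSum P N).comp (by fun_prop)
  rw [he, iteratedDeriv_fun_sub (hslice.of_le (mod_cast le_top)).contDiffAt
    (hT.of_le (mod_cast le_top)).contDiffAt, hPF k _ hnorm, iteratedDeriv_taylorSum_smul hP hk,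
    sub_self]

lemma IsSHZ2.norm_eval_le (hF : IsSHZ2 F)
    (hPF : ∀ l, ∀ ω : EuclideanSpace ℝ (Fin n), ‖ω‖ = 1 →
      iteratedDeriv l (fun r : ℝ => F (r, ω)) 0 = MvPolynomial.eval (fun i => (ω i : ℂ)) (P l))
    (l : ℕ) {ω : EuclideanSpace ℝ (Fin n)} (hω : ‖ω‖ = 1) :
    ‖MvPolynomial.eval (fun i => (ω i : ℂ)) (P l)‖ ≤ shSemi 0 l F := by
  have hmem := prodMk_mem_of_norm_eq_one 0 hω
  rw [← hPF l ω hω, congrFun (iteratedDeriv_slice isOpen_ne hF.2.2.1 hmem.2 l) 0]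
  exact (norm_radialDeriv_iterate_le (isOpen_univ_prod_ne_zero _) hF.2.2.1 l hmem).trans
    (by simpa using hF.le_shSemi 0 l 0 hω)

lemma exists_norm_iteratedFDeriv_remainder_le (hn : 0 < n) (m : ℕ) :
    ∃ C > (0 : ℝ), ∀ (F : ℝ × EuclideanSpace ℝ (Fin n) → ℂ) (P : ℕ → MvPolynomial (Fin n) ℂ),
      IsSHZ2 F → (∀ l, (P l).IsHomogeneous l) →
      (∀ l, ∀ ω : EuclideanSpace ℝ (Fin n), ‖ω‖ = 1 →
        iteratedDeriv l (fun r : ℝ => F (r, ω)) 0 =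
          MvPolynomial.eval (fun i => (ω i : ℂ)) (P l)) →
      ∀ S : ℝ, (∀ i ≤ 2 * m + 2, shSemi 0 i F ≤ S) →
      ∀ j ≤ m, ∀ ξ : EuclideanSpace ℝ (Fin n), ξ ≠ 0 → ‖ξ‖ ≤ 1 →
        ‖iteratedFDeriv ℝ j (fun ξ => F (‖ξ‖, ξ) - taylorSum P (2 * m + 2) ξ) ξ‖
          ≤ C * S * ‖ξ‖ ^ 2 := by
  set N := 2 * m + 2 with hN
  obtain ⟨C₁, hC₁, h₁⟩ := exists_norm_iteratedFDeriv_taylorSum_le (n := n) hn N N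
  obtain ⟨C₂, hC₂, h₂⟩ :=
    exists_norm_iteratedFDeriv_comp_div_norm_smul_le (V := EuclideanSpace ℝ (Fin n)) (W := ℂ) N
  choose C₃ hC₃ h₃ using fun j =>
    exists_norm_iteratedFDeriv_comp_norm_prodMk_le (V := EuclideanSpace ℝ (Fin n)) (W := ℂ) j
  have hSC : ∀ j ≤ m, C₃ j ≤ ∑ j ∈ Finset.range (m + 1), C₃ j := fun j hj =>
    Finset.single_le_sum (fun i _ => (hC₃ i).le) (Finset.mem_range.2 (by omega))
  have hSC0 : 0 < ∑ j ∈ Finset.range (m + 1), C₃ j := (hC₃ 0).trans_le (hSC 0 (Nat.zero_le _))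
  refine ⟨(∑ j ∈ Finset.range (m + 1), C₃ j) * (1 + C₂ * C₁), by positivity,
    fun F P hF hP hPF S hS j hj ξ hξ hξ1 => ?_⟩
  have hU : IsOpen {x : EuclideanSpace ℝ (Fin n) | x ≠ 0} := isOpen_ne
  have hs := isOpen_univ_prod_ne_zero (EuclideanSpace ℝ (Fin n))
  have hS0 : 0 ≤ S := (shSemi_nonneg 0 0 F).trans (hS 0 (Nat.zero_le _))
  have hFS : ∀ i ≤ N, ∀ (r : ℝ) (ω : EuclideanSpace ℝ (Fin n)), ‖ω‖ = 1 →
      ‖iteratedFDeriv ℝ i F (r, ω)‖ ≤ S := fun i hi r ω hω => by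
    simpa using (hF.le_shSemi 0 i r hω).trans (hS i hi)
  have hPS : ∀ l < N, ∀ ω : EuclideanSpace ℝ (Fin n), ‖ω‖ = 1 →
      ‖MvPolynomial.eval (fun i => (ω i : ℂ)) (P l)‖ ≤ S :=
    fun l hl ω hω => (hF.norm_eval_le hPF l hω).trans (hS l hl.le)
  set G := radialRemainder F P N with hGdef
  have hG : ContDiffOn ℝ ∞ G (Set.univ ×ˢ {x | x ≠ 0}) := hF.contDiffOn_radialRemainder P N
  set B := (1 + C₂ * C₁) * S with hB
  have hB0 : 0 ≤ B := by positivity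
  have hGN : ∀ ω : EuclideanSpace ℝ (Fin n), ‖ω‖ = 1 → ∀ r : ℝ, |r| ≤ 1 →
      ‖iteratedFDeriv ℝ N G (r, ω)‖ ≤ B := by
    intro ω hω r hr
    have hmem := hs.mem_nhds (prodMk_mem_of_norm_eq_one r hω)
    have hT := h₂ (taylorSum P N) (contDiff_taylorSum P N) r ω (C₁ * S) hω fun i hi =>
      h₁ P hP S hPS hS0 i hi _ (by simpa [norm_smul, hω] using hr)
    rw [max_eq_left hr, one_pow, mul_one] at hT
    have hsub : iteratedFDeriv ℝ N G (r, ω) = iteratedFDeriv ℝ N F (r, ω) -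
        iteratedFDeriv ℝ N (fun q : ℝ × EuclideanSpace ℝ (Fin n) =>
          taylorSum P N ((q.1 / ‖q.2‖) • q.2)) (r, ω) :=
      iteratedFDeriv_sub_apply ((hF.2.2.1.contDiffAt hmem).of_le (mod_cast le_top))
        (((contDiffOn_taylorSum_polar P N).contDiffAt hmem).of_le (mod_cast le_top))
    rw [hsub]
    refine (norm_sub_le _ _).trans ((add_le_add (hFS N le_rfl r ω hω) hT).trans_eq ?_)
    rw [hB]; ring
  obtain ⟨η, hη, hξη⟩ := exists_norm_eq_one_smul hn ξ
  set ρ := ‖ξ‖ with hρ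
  have hρ0 : 0 < ρ := norm_pos_iff.2 hξ
  have hGi : ∀ i ≤ j, ‖iteratedFDeriv ℝ i G (ρ, η)‖ ≤ B * ρ ^ (m + 2) := by
    intro i hi
    have := norm_iteratedFDeriv_le_pow_mul hU hG (N := N)
      (prodMk_mem_of_norm_eq_one 0 hη).2 (fun i hi =>
        iteratedFDeriv_eq_zero_of_radialDeriv hU i hG (fun k hk x hx =>
          hF.radialDeriv_radialRemainder hP hPF (by omega) hx) η
          (prodMk_mem_of_norm_eq_one 0 hη).2)
      (hGN η hη) (N - i) i (by omega) ρ (by rwa [abs_of_pos hρ0])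
    rw [abs_of_pos hρ0] at this
    refine this.trans (mul_le_mul_of_nonneg_left ?_ hB0)
    exact pow_le_pow_of_le_one hρ0.le hξ1 (by omega)
  have hpolar := h₃ j G hG (fun r t x ht => by
    simp only [hGdef, radialRemainder, hF.1 r t x ht, div_norm_smul_smul r ht x])
    ρ η _ hρ0 hη hGi
  rw [← hξη, max_eq_left hξ1] at hpolar
  have hfun : (fun ξ : EuclideanSpace ℝ (Fin n) => G (‖ξ‖, ξ)) =
      fun ξ => F (‖ξ‖, ξ) - taylorSum P N ξ :=
    funext (radialRemainder_norm_self F P N)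
  rw [hfun] at hpolar
  have hpow : ρ ^ (m + 2) * (1 / ρ) ^ j ≤ ρ ^ 2 := by
    have : ρ ^ (m + 2) * (1 / ρ) ^ j = ρ ^ (m - j) * ρ ^ 2 := by
      obtain ⟨d, rfl⟩ := Nat.exists_eq_add_of_le hj
      rw [Nat.add_sub_cancel_left, one_div, inv_pow]
      field_simp
      ring
    rw [this]
    exact mul_le_of_le_one_left (by positivity) (pow_le_one₀ hρ0.le hξ1)
  calc _ ≤ C₃ j * (B * ρ ^ (m + 2)) * (1 / ρ) ^ j := hpolar
    _ = C₃ j * B * (ρ ^ (m + 2) * (1 / ρ) ^ j) := by ring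
    _ ≤ (∑ j ∈ Finset.range (m + 1), C₃ j) * B * ρ ^ 2 := by gcongr; exact hSC j hj
    _ = _ := by rw [hB]; ring

end Remainder

section SmoothExtension

lemma shSemi_le_sum (F : ℝ × EuclideanSpace ℝ (Fin n) → ℂ) {a b k m : ℕ} (ha : a ≤ k)
    (hb : b ≤ m) : shSemi a b F ≤
      ∑ k' ∈ Finset.range (k + 1), ∑ m' ∈ Finset.range (m + 1), shSemi k' m' F :=
  (Finset.single_le_sum (f := fun b => shSemi a b F) (fun i _ => shSemi_nonneg a i F)
    (Finset.mem_range.2 (by omega))).trans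
  (Finset.single_le_sum (f := fun a => ∑ m' ∈ Finset.range (m + 1), shSemi a m' F)
    (fun a _ => Finset.sum_nonneg fun i _ => shSemi_nonneg a i F) (Finset.mem_range.2 (by omega)))

/-- A function in `𝒮^{ℤ₂}_H`, read in polar coordinates, extends smoothly through the origin, and
its decay is controlled by the seminorms `shSemi`. -/
lemma exists_contDiff_and_norm_pow_mul_le (hn : 0 < n) (K m : ℕ) :
    ∃ C > (0 : ℝ), ∀ (F : ℝ × EuclideanSpace ℝ (Fin n) → ℂ) (g : EuclideanSpace ℝ (Fin n) → ℂ),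
      IsSHZ2 F → (∀ ξ, ξ ≠ 0 → g ξ = F (‖ξ‖, ξ)) →
      (∀ ω : EuclideanSpace ℝ (Fin n), ‖ω‖ = 1 → g 0 = F (0, ω)) →
      ContDiff ℝ m g ∧ ∀ ξ, ‖ξ‖ ^ K * ‖iteratedFDeriv ℝ m g ξ‖ ≤
        C * ∑ k' ∈ Finset.range (K + 1), ∑ m' ∈ Finset.range (2 * m + 2 + 1),
          shSemi k' m' F := by
  obtain ⟨C₁, hC₁, h₁⟩ := exists_norm_iteratedFDeriv_taylorSum_le (n := n) hn (2 * m + 2) m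
  obtain ⟨C₂, hC₂, h₂⟩ := exists_norm_iteratedFDeriv_remainder_le (n := n) hn m
  obtain ⟨C₃, hC₃, h₃⟩ :=
    exists_norm_iteratedFDeriv_comp_norm_prodMk_le (V := EuclideanSpace ℝ (Fin n)) (W := ℂ) m
  refine ⟨C₁ + C₂ + C₃, by positivity, fun F g hF hg hg0 => ?_⟩
  choose P hP hPF using hF.2.2.2.1
  set S := ∑ k' ∈ Finset.range (K + 1), ∑ m' ∈ Finset.range (2 * m + 2 + 1), shSemi k' m' F
  have hS : ∀ a ≤ K, ∀ b ≤ 2 * m + 2, shSemi a b F ≤ S := fun a ha b hb =>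
    shSemi_le_sum F ha hb
  have hS0 : 0 ≤ S := (shSemi_nonneg 0 0 F).trans (hS 0 (Nat.zero_le _) 0 (Nat.zero_le _))
  set T := taylorSum P (2 * m + 2) with hT
  set h : EuclideanSpace ℝ (Fin n) → ℂ := fun ξ => g ξ - T ξ with hh
  have hev : ∀ ξ, ξ ≠ 0 → g =ᶠ[nhds ξ] fun ξ => F (‖ξ‖, ξ) := fun ξ hξ => by
    filter_upwards [isOpen_ne.mem_nhds hξ] with ζ hζ using hg ζ hζ
  have hg_smooth : ContDiffOn ℝ ∞ g {0}ᶜ :=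
    hF.2.2.1.comp_norm_prodMk.congr fun ξ hξ => hg ξ hξ
  have hb : ∀ j ≤ m, ∀ ξ, ξ ≠ 0 → ‖ξ‖ ≤ 1 → ‖iteratedFDeriv ℝ j h ξ‖ ≤ C₂ * S * ‖ξ‖ ^ 2 := by
    intro j hj ξ hξ hξ1
    have he : h =ᶠ[nhds ξ] fun ξ => F (‖ξ‖, ξ) - T ξ := by
      filter_upwards [hev ξ hξ] with ζ hζ
      simp only [hh, hζ]
    rw [(he.iteratedFDeriv ℝ j).eq_of_nhds]
    exact h₂ F P hF hP hPF S (hS 0 (Nat.zero_le _)) j hj ξ hξ hξ1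
  have h0 : h 0 = 0 := by
    obtain ⟨η, hη, -⟩ := exists_norm_eq_one_smul hn 0
    have e1 := iteratedDeriv_taylorSum_smul hP (show 0 < 2 * m + 2 by omega) η
    have e2 := hPF 0 η hη
    simp only [iteratedDeriv_zero, zero_smul] at e1 e2
    simp only [hh, hg0 η hη, hT, e1, e2, sub_self]
  obtain ⟨hsm, hz⟩ := contDiff_of_norm_iteratedFDeriv_le_sq h0
    (hg_smooth.sub (contDiff_taylorSum P _).contDiffOn) hb
  have hTm : ContDiff ℝ m T := (contDiff_taylorSum P _).of_le (mod_cast le_top)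
  have hgh : g = h + T := by ext ξ; simp [hh]
  refine ⟨hgh ▸ hsm.add hTm, fun ξ => ?_⟩
  rcases le_or_gt ‖ξ‖ 1 with hξ1 | hξ1
  · have hhξ : ‖iteratedFDeriv ℝ m h ξ‖ ≤ C₂ * S := by
      by_cases hξ : ξ = 0
      · rw [hξ, hz m le_rfl, norm_zero]; positivity
      · refine (hb m le_rfl ξ hξ hξ1).trans (mul_le_of_le_one_right (by positivity) ?_)
        exact pow_le_one₀ (norm_nonneg _) hξ1
    have hTξ := h₁ P hP S (fun l hl ω hω =>
      (hF.norm_eval_le hPF l hω).trans (hS 0 (Nat.zero_le _) l hl.le)) hS0 m le_rfl ξ hξ1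
    rw [hgh, iteratedFDeriv_add_apply hsm.contDiffAt hTm.contDiffAt]
    calc _ ≤ 1 * (C₂ * S + C₁ * S) := mul_le_mul (pow_le_one₀ (norm_nonneg _) hξ1)
          ((norm_add_le _ _).trans (add_le_add hhξ hTξ)) (norm_nonneg _) zero_le_one
      _ ≤ _ := by nlinarith [mul_nonneg hC₃.le hS0]
  · obtain ⟨η, hη, hξη⟩ := exists_norm_eq_one_smul hn ξ
    have hξ : ξ ≠ 0 := norm_pos_iff.1 (zero_lt_one.trans hξ1)
    rw [((hev ξ hξ).iteratedFDeriv ℝ m).eq_of_nhds]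
    set ρ := ‖ξ‖ with hρ
    have hρ0 : 0 < ρ := zero_lt_one.trans hξ1
    have := h₃ F hF.2.2.1 hF.1 ρ η (S / ρ ^ K) hρ0 hη fun i hi => by
      rw [le_div_iff₀ (by positivity), mul_comm]
      refine (mul_le_mul_of_nonneg_right ?_ (norm_nonneg _)).trans
        ((hF.le_shSemi K i ρ hη).trans (hS K le_rfl i (by omega)))
      exact pow_le_pow_left₀ hρ0.le (by nlinarith) K
    rw [← hξη, max_eq_right hξ1.le, div_self hρ0.ne', one_pow, mul_one] at this
    calc _ ≤ ρ ^ K * (C₃ * (S / ρ ^ K)) := by gcongr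
      _ = C₃ * S := by field_simp
      _ ≤ _ := by nlinarith [mul_nonneg hC₁.le hS0, mul_nonneg hC₂.le hS0]

end SmoothExtension

section Polar

lemma isHomogeneous_sum_prod_X {k : ℕ} (a : (Fin k → Fin n) → ℂ) :
    (∑ s : Fin k → Fin n, MvPolynomial.C (a s) * ∏ j, MvPolynomial.X (s j) :
      MvPolynomial (Fin n) ℂ).IsHomogeneous k := by
  refine MvPolynomial.IsHomogeneous.sum _ _ _ fun s _ => ?_
  have h := (MvPolynomial.isHomogeneous_C (Fin n) (a s)).mul
    (MvPolynomial.IsHomogeneous.prod Finset.univ (fun j => MvPolynomial.X (s j)) (fun _ => 1)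
      fun j _ => MvPolynomial.isHomogeneous_X ℂ (s j))
  simpa using h

lemma exists_isHomogeneous_iteratedDeriv_eq {h : EuclideanSpace ℝ (Fin n) → ℂ}
    (hh : ContDiff ℝ ∞ h) (k : ℕ) :
    ∃ P : MvPolynomial (Fin n) ℂ, P.IsHomogeneous k ∧ ∀ x : EuclideanSpace ℝ (Fin n),
      iteratedDeriv k (fun r : ℝ => h (r • x)) 0 = MvPolynomial.eval (fun i => (x i : ℂ)) P := by
  set e : Fin n → EuclideanSpace ℝ (Fin n) := fun i => EuclideanSpace.single i 1
  refine ⟨_, isHomogeneous_sum_prod_X fun s => iteratedFDeriv ℝ k h 0 fun j => e (s j),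
    fun x => ?_⟩
  have hx : x = ∑ i, x i • e i := by
    have := (EuclideanSpace.basisFun (Fin n) ℝ).sum_repr x
    simpa [e] using this.symm
  have hcomp : (fun r : ℝ => h (r • x)) = h ∘ (ContinuousLinearMap.toSpanSingleton ℝ x) := by
    ext r; simp
  rw [iteratedDeriv_eq_iteratedFDeriv, hcomp,
    ContinuousLinearMap.iteratedFDeriv_comp_right _ hh 0 (i := k) (mod_cast le_top)]
  have h1 : ((iteratedFDeriv ℝ k h (ContinuousLinearMap.toSpanSingleton ℝ x 0)).compContinuousLinearMap
      fun _ => ContinuousLinearMap.toSpanSingleton ℝ x) (fun _ => 1) =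
      iteratedFDeriv ℝ k h 0 fun _ => ∑ i, x i • e i := by
    rw [ContinuousMultilinearMap.compContinuousLinearMap_apply, ← hx]
    simp
  rw [h1, ContinuousMultilinearMap.map_sum]
  simp only [ContinuousMultilinearMap.map_smul_univ, map_sum, map_mul, map_prod,
    MvPolynomial.eval_C, MvPolynomial.eval_X]
  refine Finset.sum_congr rfl fun s _ => ?_
  rw [Complex.real_smul, mul_comm]
  push_cast
  rfl

lemma norm_div_norm_smul {V : Type*} [NormedAddCommGroup V] [NormedSpace ℝ V] (r : ℝ) {ω : V}
    (hω : ‖ω‖ = 1) : (r / ‖ω‖) • ω = r • ω := by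
  rw [hω, div_one]

lemma exists_norm_iteratedFDeriv_polar_le (k m : ℕ) :
    ∃ C > (0 : ℝ), ∀ (h : SchwartzMap (EuclideanSpace ℝ (Fin n)) ℂ) (r : ℝ)
      (ω : EuclideanSpace ℝ (Fin n)), ‖ω‖ = 1 →
      (1 + r ^ 2) ^ k * ‖iteratedFDeriv ℝ m (fun q : ℝ × EuclideanSpace ℝ (Fin n) =>
        h ((q.1 / ‖q.2‖) • q.2)) (r, ω)‖ ≤ C * (Finset.Iic (2 * k + m, m)).sup
          (fun p => SchwartzMap.seminorm ℝ p.1 p.2) h := by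
  obtain ⟨C, hC0, hC⟩ :=
    exists_norm_iteratedFDeriv_comp_div_norm_smul_le (V := EuclideanSpace ℝ (Fin n)) (W := ℂ) m
  refine ⟨C * 2 ^ (2 * k + m), by positivity, fun h r ω hω => ?_⟩
  set A := (Finset.Iic (2 * k + m, m)).sup
          (fun p => SchwartzMap.seminorm ℝ p.1 p.2) h with hA
  have hA0 : 0 ≤ A := apply_nonneg _ _
  have hnorm : ‖r • ω‖ = |r| := by rw [norm_smul, hω, mul_one, Real.norm_eq_abs]
  have hr : 0 < 1 + |r| := by positivity
  have hb := hC h h.smooth' r ω (2 ^ (2 * k + m) * A / (1 + |r|) ^ (2 * k + m)) hω fun i hi => by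
    rw [le_div_iff₀ (by positivity), mul_comm, ← hnorm]
    exact SchwartzMap.one_add_le_sup_seminorm_apply (m := (2 * k + m, m)) le_rfl hi h _
  have h1 : (1 + r ^ 2) ^ k ≤ (1 + |r|) ^ (2 * k) := by
    rw [pow_mul]
    refine pow_le_pow_left₀ (by positivity) ?_ k
    nlinarith [abs_nonneg r, sq_abs r]
  have h2 : (max 1 |r|) ^ m ≤ (1 + |r|) ^ m :=
    pow_le_pow_left₀ (by positivity) (max_le (by linarith [abs_nonneg r]) (by linarith)) m
  calc _ ≤ (1 + |r|) ^ (2 * k) * (C * (2 ^ (2 * k + m) * A / (1 + |r|) ^ (2 * k + m)) *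
        (1 + |r|) ^ m) := by
        refine mul_le_mul h1 (hb.trans ?_) (norm_nonneg _) (by positivity)
        gcongr
    _ = C * 2 ^ (2 * k + m) * A := by
        rw [pow_add (1 + |r|)]
        field_simp

/-- A Schwartz function, read in polar coordinates, belongs to `𝒮^{ℤ₂}_H`. -/
lemma isSHZ2_polar (h : SchwartzMap (EuclideanSpace ℝ (Fin n)) ℂ) :
    IsSHZ2 (fun q : ℝ × EuclideanSpace ℝ (Fin n) => h ((q.1 / ‖q.2‖) • q.2)) := by
  refine ⟨fun r t x ht => ?_, fun r x => ?_, h.smooth'.comp_contDiffOn contDiffOn_div_norm_smul,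
    fun k => ?_, fun k m => ?_⟩
  · simp only [div_norm_smul_smul r ht x]
  · simp only [norm_neg, neg_div, smul_neg, neg_smul, neg_neg]
  · obtain ⟨P, hP, hPh⟩ := exists_isHomogeneous_iteratedDeriv_eq h.smooth' k
    refine ⟨P, hP, fun ω hω => ?_⟩
    simp only [norm_div_norm_smul _ hω, ← hPh]
    rfl
  · obtain ⟨C, -, hC⟩ := exists_norm_iteratedFDeriv_polar_le (n := n) k m
    refine ⟨C * (Finset.Iic (2 * k + m, m)).sup (fun p => SchwartzMap.seminorm ℝ p.1 p.2) h,
      fun r ω hω => ?_⟩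
    rw [iteratedFDerivWithin_of_isOpen m (isOpen_univ_prod_ne_zero _)
      (prodMk_mem_of_norm_eq_one r hω)]
    exact hC h r ω hω

end Polar

section Continuity

/-- A continuous seminorm on the Schwartz space is bounded by a sum of the standard seminorms. -/
lemma exists_le_sum_seminorm (q : Seminorm ℝ (SchwartzMap (EuclideanSpace ℝ (Fin n)) ℂ))
    (hq : Continuous q) : ∃ C > (0 : ℝ), ∃ K M : ℕ, ∀ f,
      q f ≤ C * ∑ k' ∈ Finset.range (K + 1), ∑ m' ∈ Finset.range (M + 1),
        SchwartzMap.seminorm ℝ k' m' f := by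
  obtain ⟨s, C, hC, hs⟩ :=
    Seminorm.bound_of_continuous (schwartz_withSeminorms ℝ (EuclideanSpace ℝ (Fin n)) ℂ) q hq
  refine ⟨C, by positivity, s.sup Prod.fst, s.sup Prod.snd, fun f => (hs f).trans ?_⟩
  rw [smul_apply, NNReal.smul_def, smul_eq_mul]
  gcongr
  refine (Seminorm.finset_sup_le_sum _ s f).trans ?_
  rw [← Finset.sum_product' _ _ (fun k' m' => SchwartzMap.seminorm ℝ k' m' f), _root_.sum_apply]
  refine Finset.sum_le_sum_of_subset_of_nonneg (fun p hp => ?_) fun p _ _ => apply_nonneg _ _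
  exact Finset.mem_product.2 ⟨Finset.mem_range.2 (Nat.lt_succ_of_le (Finset.le_sup hp)),
    Finset.mem_range.2 (Nat.lt_succ_of_le (Finset.le_sup hp))⟩

lemma exists_seminorm_comp_le
    (L : SchwartzMap (EuclideanSpace ℝ (Fin n)) ℂ →L[ℝ] SchwartzMap (EuclideanSpace ℝ (Fin n)) ℂ)
    (s : Finset (ℕ × ℕ)) : ∃ C > (0 : ℝ), ∃ K M : ℕ, ∀ f,
      s.sup (fun p => SchwartzMap.seminorm ℝ p.1 p.2) (L f) ≤
        C * ∑ k' ∈ Finset.range (K + 1), ∑ m' ∈ Finset.range (M + 1),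
          SchwartzMap.seminorm ℝ k' m' f := by
  set q : Seminorm ℝ (SchwartzMap (EuclideanSpace ℝ (Fin n)) ℂ) :=
    s.sup (schwartzSeminormFamily ℝ (EuclideanSpace ℝ (Fin n)) ℂ)
  have hcont : Continuous q :=
    Seminorm.continuous_finsetSup fun i _ =>
      (schwartz_withSeminorms ℝ (EuclideanSpace ℝ (Fin n)) ℂ).continuous_seminorm i
  exact exists_le_sum_seminorm (q.comp L.toLinearMap) (hcont.comp L.continuous)

end Continuity

section Transform

open FourierTransform

lemma SFT_eq_fourier (f : EuclideanSpace ℝ (Fin n) → ℂ) :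
    SFT f = fun q => 𝓕 f ((q.1 / ‖q.2‖) • q.2) := by
  ext q
  rw [SFT, Real.fourier_eq']
  refine integral_congr_ae (Filter.Eventually.of_forall fun y => ?_)
  simp only [smul_eq_mul]
  rw [mul_comm (f y)]
  congr 2
  have : inner ℝ y ((q.1 / ‖q.2‖) • q.2) = q.1 * ((∑ i, y i * q.2 i) / ‖q.2‖) := by
    rw [inner_smul_right, PiLp.inner_apply]
    simp only [RCLike.inner_apply, conj_trivial, mul_comm (q.2 _)]
    ring
  rw [this]
  push_cast
  ring

lemma SFT_schwartz (f : SchwartzMap (EuclideanSpace ℝ (Fin n)) ℂ) :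
    SFT f = fun q => (𝓕 f : SchwartzMap (EuclideanSpace ℝ (Fin n)) ℂ) ((q.1 / ‖q.2‖) • q.2) := by
  rw [SFT_eq_fourier, SchwartzMap.fourier_coe]

/-- Every element of `𝒮^{ℤ₂}_H` is a Schwartz function read in polar coordinates. -/
lemma IsSHZ2.exists_schwartz (hn : 0 < n) {F : ℝ × EuclideanSpace ℝ (Fin n) → ℂ}
    (hF : IsSHZ2 F) : ∃ h : SchwartzMap (EuclideanSpace ℝ (Fin n)) ℂ,
      ∀ (r : ℝ) (ω : EuclideanSpace ℝ (Fin n)), ‖ω‖ = 1 → h (r • ω) = F (r, ω) := by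
  classical
  obtain ⟨P, hP, hPF⟩ := hF.2.2.2.1 0
  obtain ⟨η, hη, -⟩ := exists_norm_eq_one_smul hn 0
  have hconst : ∀ ω : EuclideanSpace ℝ (Fin n), ‖ω‖ = 1 → F (0, η) = F (0, ω) := by
    intro ω hω
    have h1 := hPF η hη
    have h2 := hPF ω hω
    rw [iteratedDeriv_zero] at h1 h2
    rw [h1, h2]
    have h3 := hP.eval_smul_real 0 η
    have h4 := hP.eval_smul_real 0 ω
    simp only [zero_smul, pow_zero, one_mul] at h3 h4
    rw [← h3, ← h4]
  set g : EuclideanSpace ℝ (Fin n) → ℂ := fun ξ => if ξ = 0 then F (0, η) else F (‖ξ‖, ξ) with hg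
  have hg1 : ∀ ξ, ξ ≠ 0 → g ξ = F (‖ξ‖, ξ) := fun ξ hξ => if_neg hξ
  have hg0 : ∀ ω : EuclideanSpace ℝ (Fin n), ‖ω‖ = 1 → g 0 = F (0, ω) := fun ω hω => by
    rw [hg]; simpa using hconst ω hω
  have hpos : ∀ (r : ℝ) (ω : EuclideanSpace ℝ (Fin n)), 0 < r → ‖ω‖ = 1 →
      g (r • ω) = F (r, ω) := by
    intro r ω hr hω
    have hω0 : ω ≠ 0 := by rintro rfl; simp at hω
    rw [hg1 _ (smul_ne_zero hr.ne' hω0), hF.1 _ _ _ hr, norm_smul, hω, mul_one, Real.norm_eq_abs,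
      abs_of_pos hr]
  refine ⟨⟨g, ?_, fun K m => ?_⟩, fun r ω hω => ?_⟩
  · rw [contDiff_infty]
    intro m
    obtain ⟨C, -, hC⟩ := exists_contDiff_and_norm_pow_mul_le hn 0 m
    exact (hC F g hF hg1 hg0).1
  · obtain ⟨C, -, hC⟩ := exists_contDiff_and_norm_pow_mul_le hn K m
    exact ⟨_, (hC F g hF hg1 hg0).2⟩
  · change g (r • ω) = F (r, ω)
    rcases lt_trichotomy r 0 with hr | rfl | hr
    · rw [← hF.2.1, ← hpos (-r) (-ω) (neg_pos.2 hr) (by rwa [norm_neg])]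
      simp
    · rw [zero_smul, hg0 ω hω]
    · exact hpos r ω hr hω

/-- A Schwartz function is controlled by its polar form. -/
lemma exists_seminorm_le_shSemi_polar (hn : 0 < n) (K m : ℕ) :
    ∃ C > (0 : ℝ), ∀ h : SchwartzMap (EuclideanSpace ℝ (Fin n)) ℂ,
      SchwartzMap.seminorm ℝ K m h ≤
        C * ∑ k' ∈ Finset.range (K + 1), ∑ m' ∈ Finset.range (2 * m + 2 + 1),
          shSemi k' m' (fun q => h ((q.1 / ‖q.2‖) • q.2)) := by
  obtain ⟨C, hC0, hC⟩ := exists_contDiff_and_norm_pow_mul_le hn K m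
  refine ⟨C, hC0, fun h => SchwartzMap.seminorm_le_bound ℝ K m h ?_
    (hC _ h (isSHZ2_polar h) (fun ξ hξ => ?_) (fun ω hω => ?_)).2⟩
  · exact mul_nonneg hC0.le (Finset.sum_nonneg fun _ _ => Finset.sum_nonneg fun _ _ =>
      shSemi_nonneg _ _ _)
  · simp only [div_self (norm_ne_zero_iff.2 hξ), one_smul]
  · simp

lemma exists_sum_seminorm_le_shSemi_polar (hn : 0 < n) (K M : ℕ) :
    ∃ C > (0 : ℝ), ∀ h : SchwartzMap (EuclideanSpace ℝ (Fin n)) ℂ,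
      ∑ a ∈ Finset.range (K + 1), ∑ b ∈ Finset.range (M + 1), SchwartzMap.seminorm ℝ a b h ≤
        C * ∑ k' ∈ Finset.range (K + 1), ∑ m' ∈ Finset.range (2 * M + 2 + 1),
          shSemi k' m' (fun q => h ((q.1 / ‖q.2‖) • q.2)) := by
  choose C hC0 hC using fun a b => exists_seminorm_le_shSemi_polar (n := n) hn a b
  have hpos : 0 < ∑ a ∈ Finset.range (K + 1), ∑ b ∈ Finset.range (M + 1), C a b :=
    Finset.sum_pos (fun a _ => Finset.sum_pos (fun b _ => hC0 a b) (by simp)) (by simp)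
  refine ⟨_, hpos, fun h => ?_⟩
  simp only [Finset.sum_mul]
  refine Finset.sum_le_sum fun a ha => Finset.sum_le_sum fun b hb => (hC a b h).trans ?_
  rw [Finset.mem_range] at ha hb
  refine mul_le_mul_of_nonneg_left ?_ (hC0 a b).le
  have hsub := fun k' => Finset.sum_le_sum_of_subset_of_nonneg
    (f := fun m' => shSemi k' m' (fun q : ℝ × EuclideanSpace ℝ (Fin n) => h ((q.1 / ‖q.2‖) • q.2)))
    (Finset.range_subset_range.2 (show 2 * b + 2 + 1 ≤ 2 * M + 2 + 1 by omega))
    fun i _ _ => shSemi_nonneg _ _ _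
  exact (Finset.sum_le_sum fun k' _ => hsub k').trans (Finset.sum_le_sum_of_subset_of_nonneg
    (Finset.range_subset_range.2 (by omega))
    fun i _ _ => Finset.sum_nonneg fun _ _ => shSemi_nonneg _ _ _)

end Transform

end SmoothTransforms
/-- **The image of the Schwartz space under the motion-group Fourier transform.**
The transform `f ↦ ((r,ω) ↦ f̂(rω))` is a linear topological isomorphism of `𝒮(ℝⁿ)`
onto `𝒮^{ℤ₂}_H(ℝ × S^{n-1})`: it is bijective and it and its inverse are continuous for
the defining seminorms. -/
theorem stmt10 (n : ℕ) (hn : 2 ≤ n) :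
    (∀ f : SchwartzMap (EuclideanSpace ℝ (Fin n)) ℂ, IsSHZ2 (SFT f)) ∧
    (∀ f g : SchwartzMap (EuclideanSpace ℝ (Fin n)) ℂ,
      (∀ (r : ℝ) (ω : EuclideanSpace ℝ (Fin n)), ‖ω‖ = 1 →
        SFT f (r, ω) = SFT g (r, ω)) → f = g) ∧
    (∀ F : ℝ × EuclideanSpace ℝ (Fin n) → ℂ, IsSHZ2 F →
      ∃ f : SchwartzMap (EuclideanSpace ℝ (Fin n)) ℂ,
        ∀ (r : ℝ) (ω : EuclideanSpace ℝ (Fin n)), ‖ω‖ = 1 →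
          SFT f (r, ω) = F (r, ω)) ∧
    (∀ k m : ℕ, ∃ C > (0 : ℝ), ∃ K M : ℕ,
      ∀ f : SchwartzMap (EuclideanSpace ℝ (Fin n)) ℂ,
        shSemi k m (SFT f) ≤
          C * ∑ k' ∈ Finset.range (K + 1), ∑ m' ∈ Finset.range (M + 1),
            SchwartzMap.seminorm ℝ k' m' f) ∧
    (∀ K M : ℕ, ∃ C > (0 : ℝ), ∃ k m : ℕ,
      ∀ f : SchwartzMap (EuclideanSpace ℝ (Fin n)) ℂ,
        SchwartzMap.seminorm ℝ K M f ≤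
          C * ∑ k' ∈ Finset.range (k + 1), ∑ m' ∈ Finset.range (m + 1),
            shSemi k' m' (SFT f)) := by
  have hn0 : 0 < n := by omega
  have hinv : ∀ f : SchwartzMap (EuclideanSpace ℝ (Fin n)) ℂ, FourierTransformInv.fourierInv
      (FourierTransform.fourier f : SchwartzMap (EuclideanSpace ℝ (Fin n)) ℂ) = f :=
    FourierTransform.fourierInv_fourier_eq
  refine ⟨fun f => ?_, fun f g hfg => ?_, fun F hF => ?_, fun k m => ?_, fun K M => ?_⟩
  · rw [SFT_schwartz]
    exact isSHZ2_polar _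
  · have h : (FourierTransform.fourier f : SchwartzMap (EuclideanSpace ℝ (Fin n)) ℂ) =
        FourierTransform.fourier g := by
      ext x
      obtain ⟨ω, hω, hx⟩ := exists_norm_eq_one_smul hn0 x
      have := hfg ‖x‖ ω hω
      simp only [SFT_schwartz, norm_div_norm_smul _ hω] at this
      rwa [hx]
    rw [← hinv f, h, hinv]
  · obtain ⟨h, hh⟩ := hF.exists_schwartz hn0
    refine ⟨FourierTransformInv.fourierInv h, fun r ω hω => ?_⟩
    simp only [SFT_schwartz, FourierTransform.fourier_fourierInv_eq, norm_div_norm_smul _ hω]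
    exact hh r ω hω
  · obtain ⟨C₁, hC₁, h₁⟩ := exists_norm_iteratedFDeriv_polar_le (n := n) k m
    obtain ⟨C₂, hC₂, K, M, h₂⟩ := exists_seminorm_comp_le
      (SchwartzMap.fourierTransformCLM ℝ) (Finset.Iic (2 * k + m, m))
    refine ⟨C₁ * C₂, by positivity, K, M, fun f => ?_⟩
    rw [SFT_schwartz]
    have hle := fun r ω hω => (h₁ (FourierTransform.fourier f) r ω hω).trans
      (mul_le_mul_of_nonneg_left (h₂ f) hC₁.le)
    rw [mul_assoc]
    exact shSemi_le (mul_nonneg hC₁.le (mul_nonneg hC₂.le (Finset.sum_nonneg fun _ _ =>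
      Finset.sum_nonneg fun _ _ => apply_nonneg _ _))) hle
  · obtain ⟨C₁, hC₁, K', M', h₁⟩ := exists_seminorm_comp_le (n := n)
      ((SchwartzMap.compCLMOfContinuousLinearEquiv ℝ
        (LinearIsometryEquiv.neg ℝ (E := EuclideanSpace ℝ (Fin n)))) ∘L
        (SchwartzMap.fourierTransformCLM ℝ)) {(K, M)}
    obtain ⟨C₂, hC₂, h₂⟩ := exists_sum_seminorm_le_shSemi_polar hn0 K' M'
    refine ⟨C₁ * C₂, by positivity, K', 2 * M' + 2, fun f => ?_⟩
    have h := h₁ (FourierTransform.fourier f)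
    rw [Finset.sup_singleton] at h
    have hL : ((SchwartzMap.compCLMOfContinuousLinearEquiv ℝ
        (LinearIsometryEquiv.neg ℝ (E := EuclideanSpace ℝ (Fin n)))) ∘L
        (SchwartzMap.fourierTransformCLM ℝ)) (FourierTransform.fourier f) = f := by
      conv_rhs => rw [← hinv f]
      ext x
      rfl
    rw [hL] at h
    rw [SFT_schwartz, mul_assoc]
    exact h.trans (mul_le_mul_of_nonneg_left (h₂ _) hC₁.le)
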